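/- arXiv:2108.07334 — 2 statements merged into one kernel-verified Lean document; each statement's English description precedes it below -/
import Mathlib

section
/- Let 0 < ε < 1 and C > 0 be constants. There exist constants r₀, K and n₀, depending only on ε and C, such that the following holds for all even n ≥ n₀. Let A = {a₁, …, a_n} be a multiset of real numbers with ρ*(A) ≥ n^{−C}. Then for every n' with n^{ε} ≤ n' < n there exists a proper (not necessarily symmetric) GAP P of rank r' ≤ r₀ such that a_i ∈ P for at least n − n' indices i ∈ {1, …, n} (counted with multiplicity), and |P| ≤ K · √(n/n') · ρ*(A)^{−1} / (n')^{r'/2}. -/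
/-- A generalized arithmetic progression (GAP) of rank `r` in an additive abelian group,
given by its generators and dimensions. -/
structure GAPData (G : Type*) [AddCommGroup G] (r : ℕ) where
  g₀ : G
  g : Fin r → G
  N : Fin r → ℤ
  N' : Fin r → ℤ
  hle : ∀ i, N i ≤ N' i

namespace GAPData

variable {G : Type*} [AddCommGroup G] {r : ℕ}

/-- The set of elements of the GAP. -/
def toSet (P : GAPData G r) : Set G :=
  {x | ∃ m : Fin r → ℤ, (∀ i, P.N i ≤ m i ∧ m i ≤ P.N' i) ∧ x = P.g₀ + ∑ i, m i • P.g i}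

/-- A GAP is proper if every element has a unique representation. -/
def IsProper (P : GAPData G r) : Prop :=
  ∀ m m' : Fin r → ℤ, (∀ i, P.N i ≤ m i ∧ m i ≤ P.N' i) →
    (∀ i, P.N i ≤ m' i ∧ m' i ≤ P.N' i) →
    P.g₀ + ∑ i, m i • P.g i = P.g₀ + ∑ i, m' i • P.g i → m = m'

/-- A GAP is symmetric if `g₀ = 0` and `N i = -N' i` for all `i`. -/
def IsSymmetric (P : GAPData G r) : Prop :=
  P.g₀ = 0 ∧ ∀ i, P.N i = -P.N' i

end GAPData

/-- `ρ*(A)`: the largest concentration probability of `∑ i, A i * x i` where `(x i)` is a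
uniform 0-1 tuple with exactly `n/2` zero entries. -/
noncomputable def rhoStar (n : ℕ) (A : Fin n → ℝ) : ℝ :=
  ⨆ a : ℝ, ({s : Finset (Fin n) | s.card = n / 2 ∧ ∑ i ∈ s, A i = a}.ncard : ℝ) /
    (n.choose (n / 2) : ℝ)

section

open Module
open scoped Pointwise

/-- A discrete subgroup of a `d`-dimensional normed space has a basis for which the coordinates
of a vector are controlled by its norm. -/
theorem exists_reduced_basis (d : ℕ) : ∃ C : ℝ, 1 ≤ C ∧ ∀ (V : Type) [NormedAddCommGroup V]
    [NormedSpace ℝ V] [FiniteDimensional ℝ V], finrank ℝ V ≤ d →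
    ∀ Λ : AddSubgroup V, (∀ R : ℝ, {x | x ∈ Λ ∧ ‖x‖ ≤ R}.Finite) →
    ∃ (r : ℕ) (b : Fin r → V), r ≤ finrank ℝ V ∧ (∀ i, b i ∈ Λ) ∧ (∀ i, b i ≠ 0) ∧
      (∀ x ∈ Λ, ∃ n : Fin r → ℤ, x = ∑ i, n i • b i) ∧
      ∀ (n : Fin r → ℤ) (i : Fin r), |(n i : ℝ)| * ‖b i‖ ≤ C * ‖∑ j, n j • b j‖ := by
  induction d with
  | zero =>
    refine ⟨1, le_rfl, fun V _ _ _ hV Λ _ => ⟨0, Fin.elim0, Nat.zero_le _, fun i => i.elim0,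
      fun i => i.elim0, fun x _ => ⟨0, ?_⟩, fun _ i => i.elim0⟩⟩
    have : Subsingleton V := finrank_zero_iff.mp (Nat.le_zero.mp hV)
    exact Subsingleton.elim _ _
  | succ d ih =>
    obtain ⟨C, hC1, ih⟩ := ih
    refine ⟨1 + 3 * (d + 1) * C, by nlinarith [show (0 : ℝ) ≤ d from d.cast_nonneg], ?_⟩
    intro V _ _ _ hV Λ hfin
    by_cases htriv : ∀ x ∈ Λ, x = 0
    · exact ⟨0, Fin.elim0, Nat.zero_le _, fun i => i.elim0,
        fun i => i.elim0, fun x hx => ⟨0, by simp [htriv x hx]⟩, fun _ i => i.elim0⟩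
    push Not at htriv
    obtain ⟨x₀, hx₀, hx₀0⟩ := htriv
    obtain ⟨b₀, ⟨⟨hb₀, hb₀x⟩, hb₀0⟩, hmin'⟩ := Set.exists_min_image
      {x | (x ∈ Λ ∧ ‖x‖ ≤ ‖x₀‖) ∧ x ≠ 0} (fun x => ‖x‖)
      ((hfin ‖x₀‖).subset fun x hx => hx.1) ⟨x₀, ⟨hx₀, le_rfl⟩, hx₀0⟩
    have hmin : ∀ x ∈ Λ, x ≠ 0 → ‖b₀‖ ≤ ‖x‖ := by
      intro x hx hx0
      rcases le_total ‖x‖ ‖x₀‖ with h | h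
      · exact hmin' x ⟨⟨hx, h⟩, hx0⟩
      · exact hb₀x.trans h
    have hb₀pos : 0 < ‖b₀‖ := norm_pos_iff.mpr hb₀0
    let S : Submodule ℝ V := Submodule.span ℝ {b₀}
    have hS : IsClosed (S : Set V) := Submodule.closed_of_finiteDimensional S
    have hfr : finrank ℝ (V ⧸ S) + 1 = finrank ℝ V := by
      rw [← finrank_span_singleton (K := ℝ) hb₀0]
      exact Submodule.finrank_quotient_add_finrank S
    -- lifts of small norm
    have hlift : ∀ x ∈ Λ, ∀ δ : ℝ, 0 < δ → ∃ y ∈ Λ, (Submodule.Quotient.mk y : V ⧸ S) =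
        Submodule.Quotient.mk x ∧ ‖y‖ ≤ ‖(Submodule.Quotient.mk x : V ⧸ S)‖ + ‖b₀‖ / 2 + δ := by
      intro x hx δ hδ
      obtain ⟨v, hv, hvn⟩ := Submodule.Quotient.norm_mk_lt (S := S)
        (Submodule.Quotient.mk x : V ⧸ S) hδ
      obtain ⟨t, ht⟩ := Submodule.mem_span_singleton.mp ((Submodule.Quotient.eq S).mp hv)
      refine ⟨x + (round t) • b₀, Λ.add_mem hx (Λ.zsmul_mem hb₀ _), ?_, ?_⟩
      · rw [Submodule.Quotient.eq]
        refine Submodule.mem_span_singleton.mpr ⟨(round t : ℝ), ?_⟩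
        rw [add_sub_cancel_left, Int.cast_smul_eq_zsmul]
      · have : x + (round t) • b₀ = v - (t - round t) • b₀ := by
          rw [sub_smul, ht, Int.cast_smul_eq_zsmul]; abel
        rw [this]
        calc ‖v - (t - round t) • b₀‖ ≤ ‖v‖ + ‖(t - round t) • b₀‖ := norm_sub_le _ _
          _ ≤ ‖v‖ + ‖b₀‖ / 2 := by
            rw [norm_smul, Real.norm_eq_abs]
            nlinarith [abs_sub_round t]
          _ ≤ _ := by linarith
    have hlow : ∀ x ∈ Λ, (Submodule.Quotient.mk x : V ⧸ S) ≠ 0 →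
        ‖b₀‖ / 2 ≤ ‖(Submodule.Quotient.mk x : V ⧸ S)‖ := by
      intro x hx hx0
      refine le_of_forall_pos_le_add fun δ hδ => ?_
      obtain ⟨y, hy, hyx, hyn⟩ := hlift x hx δ hδ
      have : y ≠ 0 := by
        rintro rfl
        exact hx0 (by rw [← hyx]; rfl)
      linarith [hmin y hy this]
    have hlift3 : ∀ x ∈ Λ, (Submodule.Quotient.mk x : V ⧸ S) ≠ 0 →
        ∃ y ∈ Λ, (Submodule.Quotient.mk y : V ⧸ S) =
        Submodule.Quotient.mk x ∧ ‖y‖ ≤ 3 * ‖(Submodule.Quotient.mk x : V ⧸ S)‖ := by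
      intro x hx hx0
      obtain ⟨y, hy, hyx, hyn⟩ := hlift x hx (‖b₀‖ / 2) (by linarith)
      exact ⟨y, hy, hyx, by linarith [hlow x hx hx0]⟩
    let Λ' : AddSubgroup (V ⧸ S) := Λ.map S.mkQ.toAddMonoidHom
    have hmem' : ∀ q ∈ Λ', ∃ x ∈ Λ, (Submodule.Quotient.mk x : V ⧸ S) = q := by
      rintro q ⟨x, hx, rfl⟩
      exact ⟨x, hx, rfl⟩
    obtain ⟨r, b', hr, hb'mem, hb'0, hb'span, hb'ineq⟩ := ih (V ⧸ S) (by omega) Λ' (by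
      intro R
      refine ((hfin (R + ‖b₀‖ / 2 + 1)).image (fun x => (Submodule.Quotient.mk x : V ⧸ S))).subset ?_
      rintro q ⟨hq, hqR⟩
      obtain ⟨x, hx, rfl⟩ := hmem' q hq
      obtain ⟨y, hy, hyx, hyn⟩ := hlift x hx 1 one_pos
      exact ⟨y, ⟨hy, by linarith⟩, hyx⟩)
    have : ∀ i, ∃ y ∈ Λ, (Submodule.Quotient.mk y : V ⧸ S) = b' i ∧ ‖y‖ ≤ 3 * ‖b' i‖ := by
      intro i
      obtain ⟨x, hx, hxb⟩ := hmem' _ (hb'mem i)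
      rw [← hxb]
      exact hlift3 x hx (by rw [hxb]; exact hb'0 i)
    choose y hy hyb hyn using this
    have hmk : ∀ n : Fin r → ℤ, (Submodule.Quotient.mk (∑ i, n i • y i) : V ⧸ S) =
        ∑ i, n i • b' i := by
      intro n
      have : S.mkQ (∑ i, n i • y i) = ∑ i, n i • b' i := by
        rw [map_sum]
        refine Finset.sum_congr rfl fun i _ => ?_
        rw [map_zsmul, ← hyb i]; rfl
      exact this
    refine ⟨r + 1, Fin.cons b₀ y, by omega, ?_, ?_, ?_, ?_⟩
    · intro i
      refine Fin.cases ?_ (fun j => ?_) i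
      · exact hb₀
      · exact hy j
    · intro i
      refine Fin.cases ?_ (fun j => ?_) i
      · exact hb₀0
      · simp only [Fin.cons_succ]
        intro h0
        refine hb'0 j ?_
        rw [← hyb j, h0]; rfl
    · intro x hx
      obtain ⟨n, hn⟩ := hb'span (Submodule.Quotient.mk x) ⟨x, hx, rfl⟩
      rw [← hmk n, Submodule.Quotient.eq] at hn
      obtain ⟨t, ht⟩ := Submodule.mem_span_singleton.mp hn
      have hmemΛ : (t - round t) • b₀ ∈ Λ := by
        rw [sub_smul, ht, Int.cast_smul_eq_zsmul]
        exact Λ.sub_mem (Λ.sub_mem hx (Λ.sum_mem fun i _ => Λ.zsmul_mem (hy i) _))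
          (Λ.zsmul_mem hb₀ _)
      have hz : (t - round t) • b₀ = 0 := by
        by_contra hne
        have h1 := hmin _ hmemΛ hne
        rw [norm_smul, Real.norm_eq_abs] at h1
        nlinarith [abs_sub_round t]
      refine ⟨Fin.cons (round t) n, ?_⟩
      rw [Fin.sum_univ_succ]
      simp only [Fin.cons_zero, Fin.cons_succ]
      rw [sub_smul, ht, Int.cast_smul_eq_zsmul, sub_eq_zero, sub_eq_iff_eq_add] at hz
      exact hz
    · intro n
      have hsucc : ∀ j : Fin r, |(n j.succ : ℝ)| * ‖y j‖ ≤
          3 * C * ‖∑ j, n j • (Fin.cons b₀ y : Fin (r + 1) → V) j‖ := by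
        intro j
        have h1 := hb'ineq (fun j => n j.succ) j
        have h2 : ‖∑ j, n (Fin.succ j) • b' j‖ ≤
            ‖∑ j, n j • (Fin.cons b₀ y : Fin (r + 1) → V) j‖ := by
          have : (Submodule.Quotient.mk (∑ j, n j • (Fin.cons b₀ y : Fin (r + 1) → V) j) : V ⧸ S) =
              ∑ j, n (Fin.succ j) • b' j := by
            rw [← hmk, Submodule.Quotient.eq, Fin.sum_univ_succ]
            simp only [Fin.cons_zero, Fin.cons_succ, add_sub_cancel_right]
            exact Submodule.mem_span_singleton.mpr ⟨(n 0 : ℝ), Int.cast_smul_eq_zsmul ℝ _ _⟩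
          rw [← this]
          exact Submodule.Quotient.norm_mk_le S _
        have h3 : |(n j.succ : ℝ)| * ‖y j‖ ≤ 3 * (|(n j.succ : ℝ)| * ‖b' j‖) := by
          nlinarith [hyn j, abs_nonneg (n j.succ : ℝ)]
        nlinarith
      set N := ‖∑ j, n j • (Fin.cons b₀ y : Fin (r + 1) → V) j‖ with hN
      have hN0 : 0 ≤ N := norm_nonneg _
      have hrd : (r : ℝ) ≤ d := by exact_mod_cast (by omega : r ≤ d)
      have hCN : 0 ≤ C * N := by positivity
      intro i
      refine Fin.cases ?_ (fun j => ?_) i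
      · simp only [Fin.cons_zero]
        have h1 : (n 0) • b₀ = ∑ j, n j • (Fin.cons b₀ y : Fin (r + 1) → V) j -
            ∑ j : Fin r, n j.succ • y j := by
          rw [Fin.sum_univ_succ]
          simp only [Fin.cons_zero, Fin.cons_succ, add_sub_cancel_right]
        have h2 : |(n 0 : ℝ)| * ‖b₀‖ = ‖(n 0) • b₀‖ := by
          rw [← Int.cast_smul_eq_zsmul ℝ, norm_smul, Real.norm_eq_abs]
        have h3 : ‖∑ j : Fin r, n j.succ • y j‖ ≤ r * (3 * C * N) := by
          calc _ ≤ ∑ j : Fin r, ‖n j.succ • y j‖ := norm_sum_le _ _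
            _ ≤ ∑ _j : Fin r, 3 * C * N := by
              refine Finset.sum_le_sum fun j _ => ?_
              rw [← Int.cast_smul_eq_zsmul ℝ, norm_smul, Real.norm_eq_abs]
              exact hsucc j
            _ = _ := by simp
        rw [h2, h1]
        have h4 := norm_sub_le (∑ j, n j • (Fin.cons b₀ y : Fin (r + 1) → V) j)
            (∑ j : Fin r, n j.succ • y j)
        nlinarith
      · simp only [Fin.cons_succ]
        have := hsucc j
        nlinarith [mul_nonneg (show (0 : ℝ) ≤ d from d.cast_nonneg) hCN]

/-- In a torsion-free graph with finite balls the first coordinate determines the second. -/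
theorem snd_eq_zero_of_fst_eq_zero {V G : Type} [NormedAddCommGroup V] [AddCommGroup G]
    [IsAddTorsionFree G] {L : AddSubgroup (V × G)}
    (hfin : ∀ R : ℝ, {p | p ∈ L ∧ ‖p.1‖ ≤ R}.Finite) {p : V × G} (hp : p ∈ L) (h0 : p.1 = 0) :
    p.2 = 0 := by
  by_contra hne
  refine Set.infinite_univ (α := ℕ) ?_
  refine Set.Finite.of_finite_image (f := fun j : ℕ => j • p) ((hfin 0).subset ?_) ?_
  · rintro _ ⟨j, -, rfl⟩
    exact ⟨L.nsmul_mem hp j, by simp [h0]⟩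
  · intro i _ j _ hij
    have : i • p.2 = j • p.2 := congrArg Prod.snd hij
    exact injective_nsmul_iff_not_isOfFinAddOrder.mpr (not_isOfFinAddOrder_of_isAddTorsionFree hne) this

theorem exists_reduced_basis_graph (d : ℕ) : ∃ C : ℝ, 1 ≤ C ∧ ∀ (V : Type)
    [NormedAddCommGroup V] [NormedSpace ℝ V] [FiniteDimensional ℝ V] (G : Type) [AddCommGroup G]
    [IsAddTorsionFree G], finrank ℝ V ≤ d →
    ∀ L : AddSubgroup (V × G), (∀ R : ℝ, {p | p ∈ L ∧ ‖p.1‖ ≤ R}.Finite) →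
    ∃ (r : ℕ) (b : Fin r → V × G), r ≤ finrank ℝ V ∧ (∀ i, b i ∈ L) ∧ (∀ i, (b i).1 ≠ 0) ∧
      (∀ p ∈ L, ∃ n : Fin r → ℤ, p = ∑ i, n i • b i) ∧
      (∀ (n : Fin r → ℤ) (i : Fin r),
        |(n i : ℝ)| * ‖(b i).1‖ ≤ C * ‖(∑ j, n j • b j).1‖) ∧
      ∀ ρ : ℝ, Submodule.span ℝ {v | ∃ p ∈ L, p.1 = v ∧ ‖v‖ ≤ ρ} = ⊤ →
        r = finrank ℝ V ∧ ∀ i, ‖(b i).1‖ ≤ C * ρ := by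
  obtain ⟨C, hC1, hC⟩ := exists_reduced_basis d
  refine ⟨C, hC1, fun V _ _ _ G _ _ hV L hfin => ?_⟩
  obtain ⟨r, b, hr, hbmem, hb0, hbspan, hbineq⟩ := hC V hV (L.map (AddMonoidHom.fst V G)) (by
    intro R
    refine ((hfin R).image Prod.fst).subset ?_
    rintro x ⟨⟨p, hp, rfl⟩, hx⟩
    exact ⟨p, ⟨hp, hx⟩, rfl⟩)
  have : ∀ i, ∃ p ∈ L, p.1 = b i := fun i => by
    obtain ⟨p, hp, hpb⟩ := hbmem i
    exact ⟨p, hp, hpb⟩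
  choose p hp hpb using this
  have hfst : ∀ n : Fin r → ℤ, (∑ j, n j • p j).1 = ∑ j, n j • b j := by
    intro n
    rw [Prod.fst_sum]
    exact Finset.sum_congr rfl fun i _ => by rw [Prod.smul_fst, hpb]
  have hspan : ∀ q ∈ L, ∃ n : Fin r → ℤ, q = ∑ i, n i • p i := by
    intro q hq
    obtain ⟨n, hn⟩ := hbspan q.1 ⟨q, hq, rfl⟩
    refine ⟨n, ?_⟩
    have h1 : (q - ∑ i, n i • p i).1 = 0 := by
      rw [Prod.fst_sub, hfst, hn, sub_self]
    have h2 := snd_eq_zero_of_fst_eq_zero hfin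
      (L.sub_mem hq (L.sum_mem fun i _ => L.zsmul_mem (hp i) (n i))) h1
    exact sub_eq_zero.mp (Prod.ext h1 h2)
  refine ⟨r, p, hr, hp, fun i => by rw [hpb]; exact hb0 i, hspan,
    fun n i => by rw [hfst, hpb]; exact hbineq n i, fun ρ hρ => ?_⟩
  have hsm : ∀ n : Fin r → ℤ, ∑ j, n j • b j = ∑ j, (n j : ℝ) • b j := fun n =>
    Finset.sum_congr rfl fun j _ => (Int.cast_smul_eq_zsmul ℝ _ _).symm
  have hrV : r = finrank ℝ V := by
    refine le_antisymm hr ?_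
    have htop : Submodule.span ℝ (Set.range b) = ⊤ := by
      rw [eq_top_iff, ← hρ, Submodule.span_le]
      rintro _ ⟨q, hq, rfl, -⟩
      obtain ⟨n, rfl⟩ := hspan q hq
      rw [hfst, hsm]
      exact Submodule.sum_mem _ fun j _ =>
        Submodule.smul_mem _ _ (Submodule.subset_span ⟨j, rfl⟩)
    have := finrank_range_le_card (R := ℝ) b
    rw [Set.finrank, htop, finrank_top] at this
    simpa using this
  refine ⟨hrV, fun i => ?_⟩
  by_contra! hlt
  have hzero : ∀ n : Fin r → ℤ, ‖∑ j, n j • b j‖ ≤ ρ → n i = 0 := by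
    intro n hn
    by_contra hni
    have h1 : (1 : ℝ) ≤ |(n i : ℝ)| := by
      exact_mod_cast Int.one_le_abs hni
    have h2 := hbineq n i
    rw [hpb] at hlt
    nlinarith [norm_nonneg (b i)]
  have htop : Submodule.span ℝ (Set.range fun j : {j : Fin r // j ≠ i} => b j) = ⊤ := by
    rw [eq_top_iff, ← hρ, Submodule.span_le]
    rintro _ ⟨q, hq, rfl, hqρ⟩
    obtain ⟨n, rfl⟩ := hspan q hq
    rw [hfst] at hqρ ⊢
    have hni := hzero n hqρ
    refine Submodule.sum_mem _ fun j _ => ?_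
    by_cases hj : j = i
    · subst hj
      rw [hni, zero_smul]
      exact Submodule.zero_mem _
    · rw [← Int.cast_smul_eq_zsmul ℝ]
      exact Submodule.smul_mem _ _ (Submodule.subset_span ⟨⟨j, hj⟩, rfl⟩)
  have := finrank_range_le_card (R := ℝ) fun j : {j : Fin r // j ≠ i} => b j
  rw [Set.finrank, htop, finrank_top] at this
  have h2 : Fintype.card {j : Fin r // j ≠ i} < r := by
    have := Fintype.card_subtype_lt (p := fun j : Fin r => j ≠ i) (x := i) (by simp)
    simpa using this
  omega

/-- Rounding a vector of the real span of `U` to a subgroup containing `U`. -/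
theorem exists_round_span {V : Type} [NormedAddCommGroup V] [NormedSpace ℝ V]
    [FiniteDimensional ℝ V] {U : Set V} {R : ℝ} (hR : 0 ≤ R) (hU : ∀ u ∈ U, ‖u‖ ≤ R)
    {Λ : AddSubgroup V} (hUΛ : U ⊆ Λ) {v : V} (hv : v ∈ Submodule.span ℝ U) :
    ∃ w ∈ Λ, ‖v - w‖ ≤ finrank ℝ V * R := by
  obtain ⟨B, hBU, hBspan, hBli⟩ := exists_linearIndependent ℝ U
  have : Finite B := hBli.setFinite
  have := Fintype.ofFinite B
  have hcard := hBli.fintype_card_le_finrank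
  rw [← hBspan, ← Subtype.range_coe (s := B)] at hv
  obtain ⟨t, rfl⟩ := (Submodule.mem_span_range_iff_exists_fun ℝ).mp hv
  refine ⟨∑ i : B, ⌊t i⌋ • (i : V),
    Λ.sum_mem fun i _ => Λ.zsmul_mem (hUΛ (hBU i.2)) _, ?_⟩
  rw [← Finset.sum_sub_distrib]
  calc ‖∑ i : B, (t i • (i : V) - ⌊t i⌋ • (i : V))‖
      ≤ ∑ i : B, ‖t i • (i : V) - ⌊t i⌋ • (i : V)‖ := norm_sum_le _ _
    _ ≤ ∑ _i : B, R := by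
      refine Finset.sum_le_sum fun i _ => ?_
      rw [← Int.cast_smul_eq_zsmul ℝ, ← sub_smul, norm_smul, Real.norm_eq_abs,
        Int.self_sub_floor, abs_of_nonneg (Int.fract_nonneg _)]
      have := hU i (hBU i.2)
      nlinarith [Int.fract_lt_one (t i), Int.fract_nonneg (t i), norm_nonneg (i : V)]
    _ = Fintype.card B * R := by simp
    _ ≤ _ := by gcongr

/-- Among the real spans of the kernel elements of a graph at geometrically growing radii, two
consecutive ones agree. -/
theorem exists_stable_span {V : Type} [NormedAddCommGroup V] [NormedSpace ℝ V]
    [FiniteDimensional ℝ V] {d : ℕ} (hd : finrank ℝ V ≤ d) (H : ℕ → Submodule ℝ V)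
    (hH : Monotone H) : ∃ j ≤ d, H (j + 1) = H j := by
  by_contra! hne
  have h : ∀ j ≤ d + 1, j ≤ finrank ℝ (H j) := by
    intro j
    induction j with
    | zero => simp
    | succ j ih =>
      intro hj
      have h1 := ih (by omega)
      have h2 : H j < H (j + 1) :=
        lt_of_le_of_ne (hH (Nat.le_succ j)) (hne j (by omega)).symm
      have h3 := Submodule.finrank_lt_finrank_of_lt h2
      omega
  have h1 := h (d + 1) le_rfl
  have h2 := Submodule.finrank_le (H (d + 1))
  omega

/-- Quotienting a graph by the real span of its small kernel elements, when this span is stable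
under enlarging the radius, gives a graph which is injective on a ball. -/
theorem exists_quotient_graph {V : Type} [NormedAddCommGroup V] [NormedSpace ℝ V]
    [FiniteDimensional ℝ V] {G : Type} [AddCommGroup G] [IsAddTorsionFree G] {d : ℕ}
    (hd : finrank ℝ V ≤ d) {L : AddSubgroup (V × G)}
    (hfin : ∀ R : ℝ, {p | p ∈ L ∧ ‖p.1‖ ≤ R}.Finite) {ρ : ℝ} (hρ : 0 < ρ) :
    ∃ R : ℝ, ρ ≤ R ∧ R * (d + 3) ≤ ρ * (d + 3) ^ (d + 1) ∧
    ∃ (W : Type) (_ : NormedAddCommGroup W) (_ : NormedSpace ℝ W) (_ : FiniteDimensional ℝ W)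
      (Q : AddSubgroup (W × G)), finrank ℝ W ≤ d ∧
      (∀ R' : ℝ, {p | p ∈ Q ∧ ‖p.1‖ ≤ R'}.Finite) ∧
      (∀ p ∈ L, ∃ q ∈ Q, q.2 = p.2 ∧ ‖q.1‖ ≤ ‖p.1‖) ∧
      (∀ q ∈ Q, ‖q.1‖ < R → ∃ p ∈ L, p.2 = q.2 ∧ ‖p.1‖ ≤ R * (d + 3)) ∧
      (∀ q ∈ Q, ‖q.1‖ < 2 * R → q.2 = 0 → q.1 = 0) := by
  let U : ℕ → Set V := fun j => {v | (v, (0 : G)) ∈ L ∧ ‖v‖ ≤ ρ * (d + 3) ^ j}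
  have hd0 : (0 : ℝ) ≤ d := d.cast_nonneg
  obtain ⟨j, hj, hjeq⟩ := exists_stable_span hd (fun j => Submodule.span ℝ (U j)) (by
    intro i j hij
    refine Submodule.span_mono fun v hv => ⟨hv.1, hv.2.trans ?_⟩
    gcongr
    linarith)
  set R := ρ * ((d : ℝ) + 3) ^ j with hR
  have hRpos : 0 < R := by positivity
  let H : Submodule ℝ V := Submodule.span ℝ (U j)
  have : IsClosed (H : Set V) := Submodule.closed_of_finiteDimensional H
  let K₀ : AddSubgroup V := L.comap (AddMonoidHom.inl V G) ⊓ H.toAddSubgroup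
  have hround : ∀ v ∈ H, ∃ w ∈ H, (w, (0 : G)) ∈ L ∧ ‖v - w‖ ≤ d * R := by
    intro v hv
    obtain ⟨w, hw, hvw⟩ := exists_round_span hRpos.le (U := U j) (fun u hu => hu.2)
      (Λ := K₀) (fun u hu => ⟨hu.1, Submodule.subset_span hu⟩) hv
    exact ⟨w, hw.2, hw.1, hvw.trans (by gcongr)⟩
  let f : V × G →+ (V ⧸ H) × G := AddMonoidHom.prodMap H.mkQ.toAddMonoidHom (AddMonoidHom.id G)
  have hlift : ∀ q ∈ L.map f, ∀ r : ℝ, ‖q.1‖ < r → ∃ p ∈ L, f p = q ∧ ‖p.1‖ ≤ r + d * R := by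
    rintro _ ⟨p, hp, rfl⟩ r hr
    obtain ⟨v, hv, hvn⟩ := Submodule.Quotient.norm_mk_lt (S := H)
      (Submodule.Quotient.mk p.1 : V ⧸ H) (sub_pos.mpr hr)
    obtain ⟨w, hwH, hw, hwn⟩ := hround (p.1 - v) (by
      rw [← Submodule.Quotient.eq]; exact hv.symm)
    refine ⟨p - (w, 0), L.sub_mem hp hw, ?_, ?_⟩
    · rw [map_sub, sub_eq_self]
      exact Prod.ext ((Submodule.Quotient.mk_eq_zero H).mpr hwH) rfl
    · have h1 : (p - (w, (0 : G))).1 = v + (p.1 - v - w) := by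
        rw [Prod.fst_sub]; abel
      have h2 : ‖v‖ < r := by
        have : ‖(f p).1‖ = ‖(Submodule.Quotient.mk p.1 : V ⧸ H)‖ := rfl
        linarith
      rw [h1]
      linarith [norm_add_le v (p.1 - v - w)]
  have hf2 : ∀ p, (f p).2 = p.2 := fun _ => rfl
  refine ⟨R, ?_, ?_, V ⧸ H, inferInstance, inferInstance, inferInstance, L.map f,
    (Submodule.finrank_quotient_le H).trans hd, ?_, ?_, ?_, ?_⟩
  · exact le_mul_of_one_le_right hρ.le (one_le_pow₀ (by linarith))
  · rw [hR, mul_assoc, ← pow_succ]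
    gcongr
    linarith
  · intro R'
    refine ((hfin (R' + 1 + d * R)).image f).subset ?_
    rintro q ⟨hq, hqR⟩
    obtain ⟨p, hp, hpq, hpn⟩ := hlift q hq (R' + 1) (by linarith)
    exact ⟨p, ⟨hp, hpn⟩, hpq⟩
  · intro p hp
    exact ⟨f p, ⟨p, hp, rfl⟩, rfl, Submodule.Quotient.norm_mk_le H p.1⟩
  · intro q hq hqR
    obtain ⟨p, hp, hpq, hpn⟩ := hlift q hq R hqR
    exact ⟨p, hp, by rw [← hpq, hf2], by nlinarith⟩
  · intro q hq hqR hq2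
    obtain ⟨p, hp, rfl, hpn⟩ := hlift q hq (2 * R) hqR
    rw [hf2] at hq2
    have h1 : p.1 ∈ Submodule.span ℝ (U (j + 1)) := by
      refine Submodule.subset_span ⟨?_, ?_⟩
      · rwa [← hq2]
      · rw [pow_succ, ← mul_assoc, ← hR]
        nlinarith
    rw [hjeq] at h1
    exact (Submodule.Quotient.mk_eq_zero H).mpr h1

/-- If `X` lies in the image of a ball of radius `a` of a graph of bounded dimension and the image
of the ball of radius `c * l * a` lies in `Y`, then `X` is contained in a proper symmetric
progression whose size is controlled by `|Y|` and `l`. -/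
theorem exists_gap_of_graph (d : ℕ) (c : ℝ) (hc : 0 < c) : ∃ (K : ℝ) (l₀ : ℕ), 0 < K ∧
    ∀ (V : Type) [NormedAddCommGroup V] [NormedSpace ℝ V] [FiniteDimensional ℝ V] (G : Type)
    [AddCommGroup G] [IsAddTorsionFree G], finrank ℝ V ≤ d →
    ∀ L : AddSubgroup (V × G), (∀ R : ℝ, {p | p ∈ L ∧ ‖p.1‖ ≤ R}.Finite) →
    ∀ (X Y : Finset G) (l : ℕ) (a : ℝ), l₀ ≤ l → 0 < a →
    (∀ x ∈ X, ∃ p ∈ L, p.2 = x ∧ ‖p.1‖ ≤ a) → (∀ p ∈ L, ‖p.1‖ ≤ c * l * a → p.2 ∈ Y) →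
    ∃ (r : ℕ) (g : Fin r → G) (M : Fin r → ℕ), r ≤ d ∧
      (∀ x ∈ X, ∃ n : Fin r → ℤ, (∀ i, |n i| ≤ M i) ∧ x = ∑ i, n i • g i) ∧
      (∀ n n' : Fin r → ℤ, (∀ i, |n i| ≤ M i) → (∀ i, |n' i| ≤ M i) →
        ∑ i, n i • g i = ∑ i, n' i • g i → n = n') ∧
      (∏ i, (2 * (M i : ℝ) + 1)) * (l : ℝ) ^ r ≤ K * Y.card := by
  obtain ⟨C, hC1, hC⟩ := exists_reduced_basis_graph d
  have hd0 : (0 : ℝ) ≤ d := d.cast_nonneg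
  set c' : ℝ := c / (((d : ℝ) + 3) ^ (d + 1) * (6 * (d + 1) * C)) with hc'
  have hc'pos : 0 < c' := by positivity
  refine ⟨(max 1 (2 / c')) ^ d, ⌈1 / c'⌉₊, by positivity, ?_⟩
  intro V _ _ _ G _ _ hV L hfin X Y l a hl ha hX hY
  have hcl : 1 ≤ c' * l := by
    have := (Nat.le_ceil (1 / c')).trans (Nat.cast_le.mpr hl)
    rw [div_le_iff₀ hc'pos] at this
    linarith
  have hl0 : (0 : ℝ) < l := by
    by_contra h
    nlinarith
  obtain ⟨R, hρR, hRle, W, _, _, _, Q, hW, hQfin, hQX, hQY, hQinj⟩ :=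
    exists_quotient_graph hV hfin
      (ρ := c * l * a / ((d : ℝ) + 3) ^ (d + 1)) (by positivity)
  rw [div_mul_cancel₀ _ (by positivity)] at hRle
  obtain ⟨r, b, hr, hbmem, hb0, hbspan, hbineq, -⟩ := hC W G hW Q hQfin
  set s : ℕ := ⌊R / (3 * (d + 1) * C * a)⌋₊ with hs
  have hsle : (s : ℝ) * (3 * (d + 1) * C * a) ≤ R := by
    rw [← le_div_iff₀ (by positivity)]
    exact Nat.floor_le (by positivity [(show (0 : ℝ) ≤ R from le_trans (by positivity) hρR)])
  have hclR : 2 * (c' * l) ≤ R / (3 * (d + 1) * C * a) := by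
    rw [le_div_iff₀ (by positivity)]
    refine le_trans (le_of_eq ?_) hρR
    rw [hc']
    field_simp
    ring
  have hsl : c' * l ≤ s := by
    have := Nat.lt_floor_add_one (R / (3 * (d + 1) * C * a))
    rw [← hs] at this
    linarith
  have hs1 : 1 ≤ s := by
    have : (0 : ℝ) < s := by linarith
    exact_mod_cast this
  have hRpos : 0 < R := lt_of_lt_of_le (by positivity) hρR
  let e := (Fintype.equivFin {i : Fin r // ‖(b i).1‖ ≤ C * a}).symm
  set r' := Fintype.card {i : Fin r // ‖(b i).1‖ ≤ C * a} with hr'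
  let u : Fin r' → Fin r := fun k => (e k : Fin r)
  have hu : Function.Injective u := Subtype.val_injective.comp e.injective
  have hur : ∀ i, i ∉ Set.range u → C * a < ‖(b i).1‖ := by
    intro i hi
    by_contra! h
    exact hi ⟨e.symm ⟨i, h⟩, by simp [u]⟩
  have hua : ∀ k, ‖(b (u k)).1‖ ≤ C * a := fun k => (e k).2
  have hupos : ∀ k, 0 < ‖(b (u k)).1‖ := fun k => norm_pos_iff.mpr (hb0 _)
  have hrank : r' ≤ d := by
    have := Fintype.card_le_of_injective u hu
    simp only [Fintype.card_fin] at this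
    omega
  let M : Fin r' → ℕ := fun k => ⌊C * a / ‖(b (u k)).1‖⌋₊
  have hM1 : ∀ k, 1 ≤ M k := fun k =>
    Nat.le_floor (by rw [Nat.cast_one, one_le_div (hupos k)]; exact hua k)
  have hMle : ∀ k, (M k : ℝ) * ‖(b (u k)).1‖ ≤ C * a := fun k => by
    rw [← le_div_iff₀ (hupos k)]
    exact Nat.floor_le (by positivity)
  have hext : ∀ n : Fin r' → ℤ,
      ∑ k, n k • b (u k) = ∑ i, (Function.extend u n 0 i) • b i := by
    intro n
    refine Fintype.sum_of_injective u hu _ _ ?_ ?_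
    · intro i hi
      rw [Function.extend_apply' _ _ _ hi]
      simp
    · intro k
      rw [hu.extend_apply]
  have hineq : ∀ (n : Fin r' → ℤ) (k : Fin r'),
      |(n k : ℝ)| * ‖(b (u k)).1‖ ≤ C * ‖(∑ k, n k • b (u k)).1‖ := by
    intro n k
    have := hbineq (Function.extend u n 0) (u k)
    rwa [hu.extend_apply, ← hext] at this
  have hqmem : ∀ n : Fin r' → ℤ, ∑ k, n k • b (u k) ∈ Q := fun n =>
    Q.sum_mem fun k _ => Q.zsmul_mem (hbmem _) _
  have hqnorm : ∀ n : Fin r' → ℤ, (∀ k, |n k| ≤ (s * M k : ℕ)) →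
      ‖(∑ k, n k • b (u k)).1‖ < R := by
    intro n hn
    rw [Prod.fst_sum]
    calc ‖∑ k, (n k • b (u k)).1‖ ≤ ∑ k, ‖(n k • b (u k)).1‖ := norm_sum_le _ _
      _ ≤ ∑ _k : Fin r', s * (C * a) := by
        refine Finset.sum_le_sum fun k _ => ?_
        rw [Prod.smul_fst, ← Int.cast_smul_eq_zsmul ℝ, norm_smul, Real.norm_eq_abs]
        have h1 : |(n k : ℝ)| ≤ s * M k := by exact_mod_cast hn k
        calc |(n k : ℝ)| * ‖(b (u k)).1‖ ≤ s * M k * ‖(b (u k)).1‖ := by gcongr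
          _ = s * (M k * ‖(b (u k)).1‖) := by ring
          _ ≤ _ := mul_le_mul_of_nonneg_left (hMle k) (Nat.cast_nonneg s)
      _ = r' * (s * (C * a)) := by simp
      _ ≤ d * (s * (C * a)) := by gcongr
      _ < R := by
        have : 0 ≤ s * (C * a) := by positivity
        nlinarith
  have hqinj : ∀ n n' : Fin r' → ℤ, (∀ k, |n k| ≤ (s * M k : ℕ)) →
      (∀ k, |n' k| ≤ (s * M k : ℕ)) →
      ∑ k, n k • (b (u k)).2 = ∑ k, n' k • (b (u k)).2 → n = n' := by
    intro n n' hn hn' h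
    have hsub : ∑ k, (n k - n' k) • b (u k) = ∑ k, n k • b (u k) - ∑ k, n' k • b (u k) := by
      rw [← Finset.sum_sub_distrib]
      exact Finset.sum_congr rfl fun k _ => sub_smul _ _ _
    have h1 : (∑ k, (n k - n' k) • b (u k)).1 = 0 := by
      refine hQinj _ (hqmem fun k => n k - n' k) ?_ ?_
      · rw [hsub, Prod.fst_sub]
        linarith [norm_sub_le (∑ k, n k • b (u k)).1 (∑ k, n' k • b (u k)).1, hqnorm n hn,
          hqnorm n' hn']
      · rw [hsub, Prod.snd_sub, Prod.snd_sum, Prod.snd_sum, sub_eq_zero]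
        exact h
    funext k
    have h2 := hineq (fun k => n k - n' k) k
    rw [h1, norm_zero, mul_zero] at h2
    have h3 : |((n k - n' k : ℤ) : ℝ)| ≤ 0 := by
      by_contra! h4
      nlinarith [hupos k]
    have h4 := abs_nonpos_iff.mp h3
    exact sub_eq_zero.mp (by exact_mod_cast h4)
  have hcount : (∏ k, (2 * ((s : ℝ) * M k) + 1)) ≤ Y.card := by
    have h1 : (Fintype.piFinset fun k : Fin r' =>
        Finset.Icc (-((s * M k : ℕ) : ℤ)) ((s * M k : ℕ) : ℤ)).card ≤ Y.card := by
      refine Finset.card_le_card_of_injOn (fun n => ∑ k, n k • (b (u k)).2) ?_ ?_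
      · intro n hn
        have hn' : ∀ k, |n k| ≤ (s * M k : ℕ) := by
          intro k
          have := Fintype.mem_piFinset.mp hn k
          rw [Finset.mem_Icc] at this
          exact abs_le.mpr this
        obtain ⟨p, hp, hp2, hpn⟩ := hQY _ (hqmem n) (hqnorm n hn')
        rw [Prod.snd_sum] at hp2
        have := hY p hp (hpn.trans hRle)
        rw [hp2] at this
        exact this
      · intro n hn n' hn' h
        refine hqinj n n' (fun k => ?_) (fun k => ?_) h
        · have := Fintype.mem_piFinset.mp hn k
          rw [Finset.mem_Icc] at this
          exact abs_le.mpr this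
        · have := Fintype.mem_piFinset.mp hn' k
          rw [Finset.mem_Icc] at this
          exact abs_le.mpr this
    rw [Fintype.card_piFinset] at h1
    have h2 : ∀ k, (Finset.Icc (-((s * M k : ℕ) : ℤ)) ((s * M k : ℕ) : ℤ)).card =
        2 * (s * M k) + 1 := by
      intro k
      rw [Int.card_Icc]
      omega
    simp only [h2] at h1
    exact_mod_cast h1
  refine ⟨r', fun k => (b (u k)).2, M, hrank, ?_, ?_, ?_⟩
  · intro x hx
    obtain ⟨p, hp, rfl, hpa⟩ := hX x hx
    obtain ⟨q, hq, hq2, hqp⟩ := hQX p hp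
    obtain ⟨n, rfl⟩ := hbspan q hq
    have hn : ∀ i, |(n i : ℝ)| * ‖(b i).1‖ ≤ C * a := fun i =>
      (hbineq n i).trans (by gcongr; exact hqp.trans hpa)
    refine ⟨fun k => n (u k), fun k => ?_, ?_⟩
    · have h1 : (((n (u k)).natAbs : ℕ) : ℝ) ≤ C * a / ‖(b (u k)).1‖ := by
        rw [le_div_iff₀ (hupos k), Nat.cast_natAbs]
        exact_mod_cast hn (u k)
      have h2 : (n (u k)).natAbs ≤ M k := Nat.le_floor h1
      rw [Int.abs_eq_natAbs]
      exact_mod_cast h2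
    · rw [← hq2, Prod.snd_sum]
      refine (Fintype.sum_of_injective u hu _ _ (fun i hi => ?_) (fun k => rfl)).symm
      have h1 : n i = 0 := by
        by_contra hne
        have h2 : (1 : ℝ) ≤ |(n i : ℝ)| := by exact_mod_cast Int.one_le_abs hne
        nlinarith [hn i, hur i hi, norm_nonneg (b i).1]
      rw [h1]
      simp
  · intro n n' hn hn' h
    have hle : ∀ k, (M k : ℤ) ≤ (s * M k : ℕ) := fun k => by
      exact_mod_cast Nat.le_mul_of_pos_left _ hs1
    exact hqinj n n' (fun k => (hn k).trans (hle k)) (fun k => (hn' k).trans (hle k)) h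
  · calc (∏ k, (2 * (M k : ℝ) + 1)) * (l : ℝ) ^ r'
        = ∏ k, ((2 * (M k : ℝ) + 1) * l) := by
          rw [Finset.prod_mul_distrib]; simp
      _ ≤ ∏ k, (2 / c' * (2 * ((s : ℝ) * M k) + 1)) := by
          refine Finset.prod_le_prod (fun k _ => by positivity) fun k _ => ?_
          have h1 : (1 : ℝ) ≤ M k := by exact_mod_cast hM1 k
          have h2 : (2 * (M k : ℝ) + 1) * (c' * l) ≤ 2 * (2 * ((s : ℝ) * M k) + 1) := by
            have : (2 * (M k : ℝ) + 1) * (c' * l) ≤ (2 * (M k : ℝ) + 1) * s := by gcongr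
            nlinarith [mul_le_mul_of_nonneg_left h1 (Nat.cast_nonneg (α := ℝ) s)]
          rw [div_mul_eq_mul_div, le_div_iff₀ hc'pos]
          linarith
      _ = (2 / c') ^ r' * ∏ k, (2 * ((s : ℝ) * M k) + 1) := by
          rw [Finset.prod_mul_distrib, Finset.prod_const, Finset.card_univ, Fintype.card_fin]
      _ ≤ (max 1 (2 / c')) ^ d * Y.card := by
          refine mul_le_mul ?_ hcount (Finset.prod_nonneg fun k _ => by positivity)
            (by positivity)
          exact (pow_le_pow_left₀ (by positivity) (le_max_right _ _) _).trans
            (pow_le_pow_right₀ (le_max_left _ _) hrank)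

/-- A character with a large Fourier coefficient on an almost invariant set is nearly trivial on
the almost periods. -/
theorem norm_one_sub_addChar_le {Γ : Type} [AddCommGroup Γ] [Fintype Γ] [DecidableEq Γ]
    {Y B : Finset Γ} {y : Γ} {δ α : ℝ} (hα : 0 < α) (hY : Y.Nonempty) (hYB : Y ⊆ B)
    (hyB : ∀ x ∈ Y, x + y ∈ B) (hB : (B.card : ℝ) ≤ (1 + δ) * Y.card) (χ : AddChar Γ ℂ)
    (hχ : α * Y.card ≤ ‖∑ x ∈ Y, χ x‖) : ‖1 - χ y‖ ≤ 2 * δ / α := by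
  have key : ∀ Y' : Finset Γ, Y' ⊆ B → Y'.card = Y.card →
      ‖∑ x ∈ B, χ x - ∑ x ∈ Y', χ x‖ ≤ δ * Y.card := by
    intro Y' hY' hc
    rw [← Finset.sum_sdiff hY', add_sub_cancel_right]
    calc ‖∑ x ∈ B \ Y', χ x‖ ≤ ∑ x ∈ B \ Y', ‖χ x‖ := norm_sum_le _ _
      _ = (B \ Y').card := by simp
      _ = B.card - Y.card := by rw [Finset.cast_card_sdiff hY', hc]
      _ ≤ _ := by linarith
  have h1 := key Y hYB rfl
  have h2 := key (Y.map (addRightEmbedding y)) (by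
    intro z hz
    obtain ⟨x, hx, rfl⟩ := Finset.mem_map.mp hz
    exact hyB x hx) (Finset.card_map _)
  rw [Finset.sum_map] at h2
  have h3 : (1 - χ y) * ∑ x ∈ Y, χ x =
      (∑ x ∈ B, χ x - ∑ x ∈ Y, χ (addRightEmbedding y x)) -
        (∑ x ∈ B, χ x - ∑ x ∈ Y, χ x) := by
    simp only [addRightEmbedding_apply, AddChar.map_add_eq_mul, ← Finset.sum_mul]
    ring
  have h4 : ‖1 - χ y‖ * ‖∑ x ∈ Y, χ x‖ ≤ 2 * δ * Y.card := by
    rw [← norm_mul, h3]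
    exact (norm_sub_le _ _).trans (by linarith)
  have hYpos : (0 : ℝ) < Y.card := by exact_mod_cast hY.card_pos
  rw [le_div_iff₀ hα]
  have h5 : ‖1 - χ y‖ * (α * Y.card) ≤ 2 * δ * Y.card :=
    (mul_le_mul_of_nonneg_left hχ (norm_nonneg _)).trans h4
  exact le_of_mul_le_mul_right (by linarith) hYpos

theorem sum_addChar_mul_conj {Γ : Type} [AddCommGroup Γ] [Fintype Γ] [DecidableEq Γ]
    (Y : Finset Γ) :
    ∑ χ : AddChar Γ ℂ, ‖∑ x ∈ Y, χ x‖ ^ 2 = (Fintype.card Γ : ℝ) * Y.card := by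
  have : ((∑ χ : AddChar Γ ℂ, ‖∑ x ∈ Y, χ x‖ ^ 2 : ℝ) : ℂ) = (Fintype.card Γ : ℂ) * Y.card := by
    push_cast
    calc ∑ χ : AddChar Γ ℂ, (‖∑ x ∈ Y, χ x‖ : ℂ) ^ 2
        = ∑ χ : AddChar Γ ℂ, ∑ x ∈ Y, ∑ y ∈ Y, χ (x - y) := by
          refine Finset.sum_congr rfl fun χ _ => ?_
          rw [← Complex.mul_conj', map_sum, Finset.sum_mul_sum]
          simp only [sub_eq_add_neg, AddChar.map_add_eq_mul, AddChar.map_neg_eq_conj]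
      _ = ∑ x ∈ Y, ∑ y ∈ Y, ∑ χ : AddChar Γ ℂ, χ (x - y) := by
          rw [Finset.sum_comm]
          exact Finset.sum_congr rfl fun x _ => Finset.sum_comm
      _ = _ := by
          simp only [AddChar.sum_apply_eq_ite, sub_eq_zero]
          simp [mul_comm]
  exact_mod_cast this

/-- Bogolyubov-type statement: the Bohr set of the large spectrum of `Y` lies in `2Y - 2Y`. -/
theorem mem_of_forall_addChar {Γ : Type} [AddCommGroup Γ] [Fintype Γ] [DecidableEq Γ]
    {Y : Finset Γ} {k β : ℝ} (hk : 0 < k) (hβ : β * k < 1) (hβ0 : 0 ≤ β) (hY : Y.Nonempty)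
    (hYY : ((Y + Y).card : ℝ) ≤ k ^ 2 * Y.card) {w : Γ}
    (hw : ∀ χ : AddChar Γ ℂ, β / 2 * Y.card ≤ ‖∑ x ∈ Y, χ x‖ → ‖1 - χ w‖ ≤ β) :
    w ∈ (Y + Y) - (Y + Y) := by
  by_contra hne
  set Z := Y + Y with hZ
  have hexp : ∀ (u : Γ) (χ : AddChar Γ ℂ), (∑ x ∈ Y, χ x) ^ 2 * (starRingEnd ℂ) (∑ z ∈ Z, χ z)
      * χ (-u) = ∑ x ∈ Y, ∑ y ∈ Y, ∑ z ∈ Z, χ (x + y - z - u) := by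
    intro u χ
    rw [sq, map_sum, Finset.sum_mul_sum, Finset.sum_mul, Finset.sum_mul]
    refine Finset.sum_congr rfl fun x _ => ?_
    rw [Finset.sum_mul, Finset.sum_mul]
    refine Finset.sum_congr rfl fun y _ => ?_
    rw [Finset.mul_sum, Finset.sum_mul]
    refine Finset.sum_congr rfl fun z _ => ?_
    rw [← AddChar.map_neg_eq_conj, ← AddChar.map_add_eq_mul, ← AddChar.map_add_eq_mul,
      ← AddChar.map_add_eq_mul, sub_eq_add_neg, sub_eq_add_neg]
  have hsum : ∀ u : Γ, ∑ χ : AddChar Γ ℂ, (∑ x ∈ Y, χ x) ^ 2 *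
      (starRingEnd ℂ) (∑ z ∈ Z, χ z) * χ (-u) =
      ∑ x ∈ Y, ∑ y ∈ Y, ∑ z ∈ Z, if x + y - z - u = 0 then (Fintype.card Γ : ℂ) else 0 := by
    intro u
    simp_rw [hexp u]
    rw [Finset.sum_comm]
    refine Finset.sum_congr rfl fun x _ => ?_
    rw [Finset.sum_comm]
    refine Finset.sum_congr rfl fun y _ => ?_
    rw [Finset.sum_comm]
    refine Finset.sum_congr rfl fun z _ => ?_
    rw [AddChar.sum_apply_eq_ite]
  have h0 : ∑ χ : AddChar Γ ℂ, (∑ x ∈ Y, χ x) ^ 2 *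
      (starRingEnd ℂ) (∑ z ∈ Z, χ z) * χ (-0) = (Fintype.card Γ : ℂ) * Y.card ^ 2 := by
    rw [hsum]
    have : ∀ x ∈ Y, ∀ y ∈ Y, (∑ z ∈ Z, if x + y - z - 0 = 0 then (Fintype.card Γ : ℂ) else 0) =
        Fintype.card Γ := by
      intro x hx y hy
      simp only [sub_zero, sub_eq_zero]
      rw [Finset.sum_ite_eq, if_pos (Finset.add_mem_add hx hy)]
    rw [Finset.sum_congr rfl fun x hx => Finset.sum_congr rfl (this x hx)]
    simp
    ring
  have h1 : ∑ χ : AddChar Γ ℂ, (∑ x ∈ Y, χ x) ^ 2 *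
      (starRingEnd ℂ) (∑ z ∈ Z, χ z) * χ (-w) = 0 := by
    rw [hsum]
    refine Finset.sum_eq_zero fun x hx => Finset.sum_eq_zero fun y hy =>
      Finset.sum_eq_zero fun z hz => if_neg fun h => hne ?_
    rw [sub_eq_zero] at h
    rw [← h]
    exact Finset.sub_mem_sub (Finset.add_mem_add hx hy) hz
  have hle : ∀ χ : AddChar Γ ℂ, ‖∑ x ∈ Y, χ x‖ * ‖1 - χ w‖ ≤ β * Y.card := by
    intro χ
    have hn : ∀ v, ‖χ v‖ = 1 := fun v => AddChar.norm_apply χ v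
    rcases le_total (β / 2 * Y.card) ‖∑ x ∈ Y, χ x‖ with h | h
    · have h2 : ‖∑ x ∈ Y, χ x‖ ≤ Y.card := (norm_sum_le _ _).trans (by simp)
      calc _ ≤ (Y.card : ℝ) * β := mul_le_mul h2 (hw χ h) (norm_nonneg _) (Nat.cast_nonneg _)
        _ = _ := mul_comm _ _
    · have h2 : ‖1 - χ w‖ ≤ 2 := (norm_sub_le _ _).trans (by rw [norm_one, hn]; norm_num)
      calc _ ≤ (β / 2 * Y.card : ℝ) * 2 := by gcongr
        _ = _ := by ring
  have hYpos : (0 : ℝ) < Y.card := by exact_mod_cast hY.card_pos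
  have hΓpos : (0 : ℝ) < Fintype.card Γ := by exact_mod_cast Fintype.card_pos
  have hfin : (Fintype.card Γ : ℝ) * Y.card ^ 2 ≤ β * k * (Fintype.card Γ * Y.card ^ 2) := by
    calc (Fintype.card Γ : ℝ) * Y.card ^ 2
        = ‖∑ χ : AddChar Γ ℂ, ((∑ x ∈ Y, χ x) ^ 2 * (starRingEnd ℂ) (∑ z ∈ Z, χ z) * χ (-0) -
          (∑ x ∈ Y, χ x) ^ 2 * (starRingEnd ℂ) (∑ z ∈ Z, χ z) * χ (-w))‖ := by
          rw [Finset.sum_sub_distrib, h0, h1, sub_zero]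
          simp
      _ ≤ ∑ χ : AddChar Γ ℂ, β * Y.card *
            ((k * ‖∑ x ∈ Y, χ x‖ ^ 2 + k⁻¹ * ‖∑ z ∈ Z, χ z‖ ^ 2) / 2) := by
          refine (norm_sum_le _ _).trans (Finset.sum_le_sum fun χ _ => ?_)
          rw [neg_zero, AddChar.map_zero_eq_one, ← mul_sub, norm_mul, norm_mul, norm_pow,
            RCLike.norm_conj, AddChar.map_neg_eq_conj]
          have e1 : ‖1 - (starRingEnd ℂ) (χ w)‖ = ‖1 - χ w‖ := by
            rw [← RCLike.norm_conj, map_sub, map_one, Complex.conj_conj]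
          rw [e1]
          set a := ‖∑ x ∈ Y, χ x‖
          set b := ‖∑ z ∈ Z, χ z‖
          have e2 : a * b ≤ (k * a ^ 2 + k⁻¹ * b ^ 2) / 2 := by
            have : 0 ≤ k⁻¹ * (k * a - b) ^ 2 := by positivity
            have e3 : k⁻¹ * (k * a - b) ^ 2 = k * a ^ 2 - 2 * (a * b) + k⁻¹ * b ^ 2 := by
              field_simp
              ring
            linarith
          calc a ^ 2 * b * ‖1 - χ w‖ = (a * ‖1 - χ w‖) * (a * b) := by ring
            _ ≤ _ := mul_le_mul (hle χ) e2 (by positivity) (by positivity)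
      _ = β * Y.card * ((k * (Fintype.card Γ * Y.card) +
            k⁻¹ * (Fintype.card Γ * Z.card)) / 2) := by
          rw [← Finset.mul_sum, ← Finset.sum_div, Finset.sum_add_distrib, ← Finset.mul_sum,
            ← Finset.mul_sum, sum_addChar_mul_conj, sum_addChar_mul_conj]
      _ ≤ β * Y.card * ((k * (Fintype.card Γ * Y.card) +
            k⁻¹ * (Fintype.card Γ * (k ^ 2 * Y.card))) / 2) := by gcongr
      _ = β * k * (Fintype.card Γ * Y.card ^ 2) := by field_simp; ring
  have : 0 < (Fintype.card Γ : ℝ) * Y.card ^ 2 := by positivity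
  nlinarith

theorem exists_injOn_finite {ι : Type} [Fintype ι] {F : Set (ι → ℤ)} (hF : F.Finite) :
    ∃ (Γ : Type) (_ : AddCommGroup Γ) (_ : Fintype Γ) (φ : (ι → ℤ) →+ Γ), Set.InjOn φ F := by
  classical
  obtain ⟨B, hB⟩ : ∃ B : ℕ, ∀ x ∈ F, ∀ i, |x i| ≤ B := by
    obtain ⟨B, hB⟩ := (hF.image fun x => ∑ i, (x i).natAbs).bddAbove
    refine ⟨B, fun x hx i => ?_⟩
    have h1 : (x i).natAbs ≤ ∑ i, (x i).natAbs :=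
      Finset.single_le_sum (f := fun i => (x i).natAbs) (fun _ _ => Nat.zero_le _)
        (Finset.mem_univ i)
    have h2 := hB (Set.mem_image_of_mem _ hx)
    rw [Int.abs_eq_natAbs]
    exact_mod_cast h1.trans h2
  let φ : (ι → ℤ) →+ (ι → ZMod (2 * B + 1)) :=
    AddMonoidHom.compLeft (Int.castAddHom (ZMod (2 * B + 1))) ι
  refine ⟨ι → ZMod (2 * B + 1), inferInstance, inferInstance, φ, fun x hx y hy hxy => ?_⟩
  funext i
  have h1 : ((x i : ℤ) : ZMod (2 * B + 1)) = (y i : ℤ) := congrFun hxy i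
  rw [ZMod.intCast_eq_intCast_iff_dvd_sub] at h1
  have h2 := Int.eq_zero_of_abs_lt_dvd h1 (by
    have h3 := hB x hx i
    have h4 := hB y hy i
    rw [abs_le] at h3 h4
    rw [abs_lt]
    push_cast
    constructor <;> linarith [h3.1, h3.2, h4.1, h4.2])
  linarith

theorem finite_ball_of_small {V G : Type} [NormedAddCommGroup V] [NormedSpace ℝ V]
    [FiniteDimensional ℝ V] [AddCommGroup G] {L : AddSubgroup (V × G)} {c : ℝ} (hc : 0 < c)
    (hfin : {p | p ∈ L ∧ ‖p.1‖ ≤ c}.Finite) (R : ℝ) : {p | p ∈ L ∧ ‖p.1‖ ≤ R}.Finite := by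
  have : ProperSpace V := FiniteDimensional.proper ℝ V
  obtain ⟨t, -, ht, hcov⟩ := (isCompact_closedBall (0 : V) R).finite_cover_balls (half_pos hc)
  have h1 : {p | p ∈ L ∧ ‖p.1‖ ≤ R} ⊆ ⋃ x ∈ t, {p | p ∈ L ∧ p.1 ∈ Metric.ball x (c / 2)} := by
    rintro p ⟨hp, hpR⟩
    have := hcov (mem_closedBall_zero_iff.mpr hpR)
    simp only [Set.mem_iUnion, Set.mem_ofPred_eq] at this ⊢
    obtain ⟨x, hx, hpx⟩ := this
    exact ⟨x, hx, hp, hpx⟩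
  refine (ht.biUnion fun x _ => ?_).subset h1
  rcases Set.eq_empty_or_nonempty {p | p ∈ L ∧ p.1 ∈ Metric.ball x (c / 2)} with h | ⟨q, hq, hqx⟩
  · rw [h]
    exact Set.finite_empty
  · refine (hfin.image fun p => p + q).subset ?_
    rintro p ⟨hp, hpx⟩
    refine ⟨p - q, ⟨L.sub_mem hp hq, ?_⟩, sub_add_cancel _ _⟩
    rw [Prod.fst_sub, ← dist_eq_norm]
    have := dist_triangle_right p.1 q.1 x
    rw [Metric.mem_ball] at hpx hqx
    linarith

/-- If the first multiples of a phase stay in a half circle, the phase is small. -/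
theorem abs_le_of_forall_norm_one_sub_lt {θ : ℝ} {h : ℕ} (hh : 0 < h) (hθ : |θ| ≤ 1 / 2)
    (hj : ∀ j : ℕ, j ≤ h → ‖1 - Complex.exp (Complex.I * ((2 * Real.pi * (j * θ) : ℝ) : ℂ))‖ < 1) :
    |θ| ≤ 1 / (4 * h) := by
  by_contra! hlt
  have hh' : (0 : ℝ) < h := by exact_mod_cast hh
  have hθpos : 0 < |θ| := lt_trans (by positivity) hlt
  set j := ⌈1 / (4 * |θ|)⌉₊ with hjdef
  have h1 : 1 / (4 * |θ|) ≤ j := Nat.le_ceil _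
  have h2 : (j : ℝ) < 1 / (4 * |θ|) + 1 := Nat.ceil_lt_add_one (by positivity)
  have h3 : j ≤ h := by
    rw [hjdef, Nat.ceil_le]
    rw [div_lt_iff₀ (by positivity)] at hlt
    rw [div_le_iff₀ (by positivity)]
    linarith
  have h4 : 1 / 4 ≤ j * |θ| := by
    rw [div_le_iff₀ (by positivity)] at h1
    linarith
  have h5 : j * |θ| ≤ 3 / 4 := by
    have : (j : ℝ) * |θ| ≤ (1 / (4 * |θ|) + 1) * |θ| := by gcongr
    have e : (1 / (4 * |θ|) + 1) * |θ| = 1 / 4 + |θ| := by field_simp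
    linarith
  have h6 : Real.cos (2 * Real.pi * (j * θ)) ≤ 0 := by
    rw [← Real.cos_abs, abs_mul, abs_mul (j : ℝ), Nat.abs_cast, abs_of_pos Real.two_pi_pos]
    apply Real.cos_nonpos_of_pi_div_two_le_of_le <;> nlinarith [Real.pi_pos]
  have h7 := hj j h3
  have h8 := (Complex.abs_re_le_norm _).trans_lt h7
  rw [Complex.sub_re, mul_comm Complex.I, Complex.exp_ofReal_mul_I_re, Complex.one_re] at h8
  rw [abs_lt] at h8
  linarith

theorem nsmul_card_mono {G : Type} [AddCommGroup G] [DecidableEq G] {X : Finset G} (h0 : 0 ∈ X)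
    {i j : ℕ} (hij : i ≤ j) : (i • X).card ≤ (j • X).card :=
  Finset.card_le_card (Finset.nsmul_subset_nsmul_right h0 hij)

/-- A scale at which the growth of the iterated sumset is slow. -/
theorem exists_slow_growth {g : ℕ → ℝ} {δ K : ℝ} (hδ : 0 < δ) {J k₀ h : ℕ} (hg : 0 < g k₀)
    (hJ : K < (1 + δ) ^ J) (hK : g (k₀ + J * h) ≤ K * g k₀) :
    ∃ j < J, g (k₀ + j * h + h) ≤ (1 + δ) * g (k₀ + j * h) := by
  by_contra! hlt
  have : ∀ j ≤ J, (1 + δ) ^ j * g k₀ ≤ g (k₀ + j * h) := by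
    intro j hj
    induction j with
    | zero => simp
    | succ j ih =>
      have h1 := hlt j hj
      have h2 := ih (Nat.le_of_succ_le hj)
      have e : k₀ + (j + 1) * h = k₀ + j * h + h := by ring
      rw [e, pow_succ', mul_assoc]
      exact (mul_le_mul_of_nonneg_left h2 (by linarith)).trans h1.le
  have h1 := this J le_rfl
  nlinarith [mul_lt_mul_of_pos_right hJ hg]

theorem exists_graph_of_doubling {K : ℝ} (hK : 1 ≤ K) :
    ∃ (c κ : ℝ) (k₀ : ℕ), 0 < c ∧ c < 1 / 2 ∧ 1 ≤ κ ∧ ∀ (m : ℕ) (X : Finset (Fin m → ℤ)) (k : ℕ),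
      0 ∈ X → -X = X → k₀ ≤ k → ((k • X).card : ℝ) ≤ K ^ 2 * ((k / 8) • X).card →
      ∃ (V : Type) (_ : NormedAddCommGroup V) (_ : NormedSpace ℝ V) (_ : FiniteDimensional ℝ V)
        (L : AddSubgroup (V × (Fin m → ℤ))), (∀ R : ℝ, {p | p ∈ L ∧ ‖p.1‖ ≤ R}.Finite) ∧
        (∀ p ∈ L, ‖p.1‖ ≤ c → p.2 ∈ k • X) ∧
        (∀ x ∈ X, ∃ p ∈ L, p.2 = x ∧ ‖p.1‖ ≤ κ / k) ∧
        ∀ p ∈ L, p.2 = 0 → ‖p.1‖ < 1 → p.1 = 0 := by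
  classical
  have hK0 : 0 < K := by linarith
  set β : ℝ := 1 / (2 * K) with hβ
  have hβ0 : 0 < β := by positivity
  have hβ1 : β ≤ 1 / 2 := by rw [hβ, div_le_iff₀ (by positivity)]; linarith
  obtain ⟨J, hJ⟩ : ∃ J : ℕ, K ^ 2 < (1 + β / 10) ^ J :=
    pow_unbounded_of_one_lt _ (by linarith)
  have hJ1 : 1 ≤ J := by
    by_contra! h0
    obtain rfl : J = 0 := by omega
    simp only [pow_zero] at hJ
    nlinarith
  refine ⟨β / 8, 4 * J, 16 * J, by positivity, by linarith, ?_, ?_⟩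
  · have : (1 : ℝ) ≤ J := by exact_mod_cast hJ1
    linarith
  intro m X k h0 hneg hk hdoub
  set h := k / (8 * J) with hh
  have hh1 : 1 ≤ h := by
    rw [hh, Nat.one_le_div_iff (by positivity)]
    omega
  have hJh : J * h ≤ k / 8 := by
    rw [hh, ← Nat.div_div_eq_div_mul]
    exact Nat.mul_div_le _ _
  have hκ : 1 / (4 * (h : ℝ)) ≤ 4 * J / k := by
    have h1 : k < 8 * J * (h + 1) := by
      rw [hh]
      exact Nat.lt_mul_div_succ k (by positivity)
    have h2 : (k : ℝ) < 8 * J * (h + 1) := by exact_mod_cast h1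
    have h3 : (1 : ℝ) ≤ h := by exact_mod_cast hh1
    have h4 : (0 : ℝ) < k := by
      have : 0 < k := by omega
      exact_mod_cast this
    rw [div_le_div_iff₀ (by positivity) h4]
    nlinarith [(Nat.cast_nonneg J : (0 : ℝ) ≤ J)]
  have hne : ∀ i : ℕ, (i • X).Nonempty := fun i => Finset.Nonempty.nsmul ⟨0, h0⟩
  obtain ⟨j, hjJ, hj⟩ := exists_slow_growth (g := fun i => ((i • X).card : ℝ)) (δ := β / 10)
    (h := h) (k₀ := k / 8) (by positivity) (by exact_mod_cast (hne _).card_pos) hJ (by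
      refine le_trans ?_ hdoub
      exact_mod_cast nsmul_card_mono h0 (by omega))
  set k₁ := k / 8 + j * h with hk₁
  have hk₁h : k₁ + h ≤ 2 * (k / 8) := by
    have : (j + 1) * h ≤ J * h := Nat.mul_le_mul_right _ hjJ
    rw [add_mul] at this
    omega
  obtain ⟨R, hR1, hR⟩ : ∃ R : ℕ, 1 ≤ R ∧ ∀ x ∈ X, ∀ i, 4 * h * |x i| ≤ R := by
    refine ⟨1 + 4 * h * ∑ x ∈ X, ∑ i, (x i).natAbs, by omega, fun x hx i => ?_⟩
    have h1 : (x i).natAbs ≤ ∑ i, (x i).natAbs :=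
      Finset.single_le_sum (f := fun i => (x i).natAbs) (fun _ _ => Nat.zero_le _)
        (Finset.mem_univ i)
    have h2 : ∑ i, (x i).natAbs ≤ ∑ x ∈ X, ∑ i, (x i).natAbs :=
      Finset.single_le_sum (f := fun x => ∑ i, (x i).natAbs) (fun _ _ => Nat.zero_le _) hx
    rw [Int.abs_eq_natAbs]
    have h3 : 4 * h * (x i).natAbs ≤ 4 * h * ∑ x ∈ X, ∑ i, (x i).natAbs :=
      Nat.mul_le_mul_left _ (h1.trans h2)
    exact_mod_cast h3.trans (Nat.le_add_left _ _)
  have hRpos : (0 : ℝ) < R := by exact_mod_cast hR1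
  obtain ⟨Γ, _, _, φ, hφ⟩ := exists_injOn_finite (F := (↑(k • X) : Set (Fin m → ℤ)) ∪
    Set.Icc (fun _ => -(R : ℤ)) (fun _ => (R : ℤ)))
    ((k • X).finite_toSet.union (Set.finite_Icc _ _))
  have hφk : ∀ i ≤ k, ((i • X).image φ).card = (i • X).card := fun i hi =>
    Finset.card_image_of_injOn (hφ.mono fun x hx => Or.inl
      (Finset.nsmul_subset_nsmul_right h0 hi hx))
  set Y := (k₁ • X).image φ with hY
  have hYne : Y.Nonempty := (hne _).image _
  set T := {χ : AddChar Γ ℂ // β / 2 * Y.card ≤ ‖∑ x ∈ Y, χ x‖} with hT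
  let e : ℝ → ℂ := fun t => Complex.exp (Complex.I * ((2 * Real.pi * t : ℝ) : ℂ))
  have he0 : e 0 = 1 := by simp [e]
  have he_add : ∀ s t, e (s + t) = e s * e t := fun s t => by
    simp only [e]
    rw [← Complex.exp_add]
    push_cast
    ring_nf
  have he_neg : ∀ t, e (-t) = (e t)⁻¹ := fun t => by
    simp only [e]
    rw [← Complex.exp_neg]
    push_cast
    ring_nf
  have he_nsmul : ∀ (n : ℕ) t, e (n * t) = e t ^ n := fun n t => by
    induction n with
    | zero => simp [he0]
    | succ n ih => rw [pow_succ, ← ih, ← he_add]; push_cast; ring_nf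
  have he_one : ∀ t, e t = 1 → ∃ z : ℤ, t = z := fun t ht => by
    obtain ⟨z, hz⟩ := Complex.exp_eq_one_iff.mp ht
    refine ⟨z, ?_⟩
    have h1 : Complex.I * 2 * Real.pi * ((t : ℂ) - z) = 0 := by
      push_cast at hz
      linear_combination hz
    have h2 : (t : ℂ) - z = 0 := by
      simpa [Complex.I_ne_zero, Real.pi_ne_zero] using h1
    exact_mod_cast sub_eq_zero.mp h2
  have he_surj : ∀ u : ℂ, ‖u‖ = 1 → ∃ t : ℝ, |t| ≤ 1 / 2 ∧ e t = u := fun u hu => by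
    refine ⟨Complex.arg u / (2 * Real.pi), ?_, ?_⟩
    · rw [abs_div, abs_of_pos Real.two_pi_pos, div_le_iff₀ Real.two_pi_pos]
      linarith [Complex.abs_arg_le_pi u]
    · have : 2 * Real.pi * (Complex.arg u / (2 * Real.pi)) = Complex.arg u := by
        field_simp
      simp only [e]
      rw [this, mul_comm]
      have h1 := Complex.norm_mul_exp_arg_mul_I u
      rwa [hu, Complex.ofReal_one, one_mul] at h1
  have he_le : ∀ t, ‖1 - e t‖ ≤ 8 * |t| := fun t => by
    rw [norm_sub_rev]
    refine (Real.norm_exp_I_mul_ofReal_sub_one_le).trans ?_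
    rw [Real.norm_eq_abs, abs_mul, abs_of_pos Real.two_pi_pos]
    nlinarith [Real.pi_lt_four, abs_nonneg t]
  let L : AddSubgroup (((T → ℝ) × (Fin m → ℝ)) × (Fin m → ℤ)) :=
    { carrier := {p | (∀ i, p.1.2 i * R = p.2 i) ∧ ∀ χ : T, e (p.1.1 χ) = χ.1 (φ p.2)}
      zero_mem' := ⟨fun i => by simp, fun χ => by simp [he0]⟩
      add_mem' := fun {p q} hp hq => ⟨fun i => by
          simp only [Prod.fst_add, Prod.snd_add, Pi.add_apply, add_mul, hp.1 i, hq.1 i]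
          push_cast; ring, fun χ => by
          simp only [Prod.fst_add, Prod.snd_add, Pi.add_apply, he_add, hp.2 χ, hq.2 χ, map_add,
            AddChar.map_add_eq_mul]⟩
      neg_mem' := fun {p} hp => ⟨fun i => by
          simp only [Prod.fst_neg, Prod.snd_neg, Pi.neg_apply, neg_mul, hp.1 i]
          push_cast; ring, fun χ => by
          simp only [Prod.fst_neg, Prod.snd_neg, Pi.neg_apply, he_neg, hp.2 χ, map_neg,
            AddChar.map_neg_eq_inv]⟩ }
  have hLmem : ∀ p, p ∈ L ↔ (∀ i, p.1.2 i * R = p.2 i) ∧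
      ∀ χ : T, e (p.1.1 χ) = χ.1 (φ p.2) := fun p => Iff.rfl
  have ha : ∀ p ∈ L, ‖p.1‖ ≤ β / 8 → p.2 ∈ k • X := by
    intro p hp hpn
    rw [hLmem] at hp
    have hn1 := (norm_fst_le p.1).trans hpn
    have hn2 := (norm_snd_le p.1).trans hpn
    have hbog := mem_of_forall_addChar (k := K) (β := β) (w := φ p.2) hK0
      (by rw [hβ]; field_simp; norm_num) hβ0.le hYne (by
        rw [hY, ← Finset.image_add, ← add_nsmul, hφk _ (by omega), hφk _ (by omega)]
        calc (((k₁ + k₁) • X).card : ℝ) ≤ (k • X).card := by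
              exact_mod_cast nsmul_card_mono h0 (by omega)
          _ ≤ K ^ 2 * ((k / 8) • X).card := hdoub
          _ ≤ K ^ 2 * (k₁ • X).card := by
              gcongr
              exact Nat.le_add_right _ _) (by
        intro χ hχ
        rw [← hp.2 ⟨χ, hχ⟩]
        refine (he_le _).trans ?_
        have h1 := (norm_le_pi_norm p.1.1 ⟨χ, hχ⟩).trans hn1
        rw [Real.norm_eq_abs] at h1
        linarith)
    rw [hY, ← Finset.image_add, ← add_nsmul, sub_eq_add_neg, ← Finset.image_neg, ← Finset.image_add, ← neg_nsmul,
      hneg, ← add_nsmul] at hbog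
    obtain ⟨w, hw, hwp⟩ := Finset.mem_image.mp hbog
    have hw' : w ∈ k • X := Finset.nsmul_subset_nsmul_right h0 (by omega) hw
    have : w = p.2 := by
      refine hφ (Or.inl hw') (Or.inr ?_) hwp
      have : ∀ i, |p.2 i| ≤ R := fun i => by
        have h1 := (norm_le_pi_norm p.1.2 i).trans hn2
        rw [Real.norm_eq_abs] at h1
        have h2 : |(p.2 i : ℝ)| ≤ R := by
          rw [← hp.1 i, abs_mul, abs_of_pos hRpos]
          nlinarith
        exact_mod_cast h2
      exact ⟨fun i => (abs_le.mp (this i)).1, fun i => (abs_le.mp (this i)).2⟩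
    exact this ▸ hw'
  have hc : ∀ p ∈ L, p.2 = 0 → ‖p.1‖ < 1 → p.1 = 0 := by
    intro p hp hp0 hpn
    rw [hLmem] at hp
    refine Prod.ext (funext fun χ => ?_) (funext fun i => ?_)
    · have h1 := hp.2 χ
      rw [hp0, map_zero, AddChar.map_zero_eq_one] at h1
      obtain ⟨z, hz⟩ := he_one _ h1
      have h2 := ((norm_le_pi_norm p.1.1 χ).trans (norm_fst_le p.1)).trans_lt hpn
      rw [Real.norm_eq_abs, hz] at h2
      have h3 : |z| < 1 := by exact_mod_cast h2
      rw [hz, Int.abs_lt_one_iff.mp h3]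
      simp
    · have h1 := hp.1 i
      rw [hp0] at h1
      simpa [hRpos.ne'] using h1
  refine ⟨_, inferInstance, inferInstance, inferInstance, L,
    finite_ball_of_small (c := β / 8) (by positivity) ?_, ha, ?_, hc⟩
  · refine Set.Finite.of_finite_image (f := Prod.snd) ((k • X).finite_toSet.subset ?_) ?_
    · rintro _ ⟨p, ⟨hp, hpn⟩, rfl⟩
      exact ha p hp hpn
    · rintro p ⟨hp, hpn⟩ q ⟨hq, hqn⟩ hpq
      refine Prod.ext (sub_eq_zero.mp ?_) hpq
      refine hc (p - q) (L.sub_mem hp hq) (sub_eq_zero.mpr hpq) ?_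
      rw [Prod.fst_sub]
      have := norm_sub_le p.1 q.1
      linarith
  · intro x hx
    choose θ hθ1 hθ2 using fun χ : T => he_surj (χ.1 (φ x)) (AddChar.norm_apply χ.1 (φ x))
    refine ⟨((θ, fun i => x i / R), x), (hLmem _).mpr ⟨fun i => by field_simp, hθ2⟩, rfl, ?_⟩
    refine le_trans ?_ hκ
    refine norm_prod_le_iff.mpr ⟨(pi_norm_le_iff_of_nonneg (by positivity)).mpr fun χ => ?_,
      (pi_norm_le_iff_of_nonneg (by positivity)).mpr fun i => ?_⟩
    · refine abs_le_of_forall_norm_one_sub_lt hh1 (hθ1 χ) fun i hi => ?_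
      change ‖1 - e (i * θ χ)‖ < 1
      rw [he_nsmul, hθ2, ← AddChar.map_nsmul_eq_pow, ← map_nsmul]
      have hix : i • x ∈ h • X :=
        Finset.nsmul_subset_nsmul_right h0 hi (Finset.nsmul_mem_nsmul hx)
      refine (norm_one_sub_addChar_le (Y := Y) (B := ((k₁ + h) • X).image φ) (δ := β / 10)
        (α := β / 2) (by positivity) hYne ?_ ?_ ?_ χ.1 χ.2).trans_lt ?_
      · exact Finset.image_subset_image (Finset.nsmul_subset_nsmul_right h0 (by omega))
      · intro z hz
        obtain ⟨y, hy, rfl⟩ := Finset.mem_image.mp hz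
        rw [← map_add, add_nsmul]
        exact Finset.mem_image_of_mem _ (Finset.add_mem_add hy hix)
      · rw [hY, hφk _ (by omega), hφk _ (by omega)]
        exact hj
      · rw [show 2 * (β / 10) / (β / 2) = 2 / 5 by field_simp; norm_num]
        norm_num
    · have h1 := hR x hx i
      have h2 : 4 * (h : ℝ) * |(x i : ℝ)| ≤ R := by exact_mod_cast h1
      have hhpos : (0 : ℝ) < h := by exact_mod_cast hh1
      rw [Real.norm_eq_abs, abs_div, abs_of_pos hRpos, div_le_div_iff₀ hRpos (by positivity)]
      linarith

theorem exists_restrict_graph {V G : Type} [NormedAddCommGroup V] [NormedSpace ℝ V]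
    [AddCommGroup G] {L : AddSubgroup (V × G)}
    (hfin : ∀ R : ℝ, {p | p ∈ L ∧ ‖p.1‖ ≤ R}.Finite) {c : ℝ} {S : Set V}
    (hS : ∀ v ∈ S, ∃ p ∈ L, p.1 = v ∧ ‖v‖ ≤ c) :
    ∃ L' : AddSubgroup (Submodule.span ℝ S × G), (∀ q, q ∈ L' ↔ ((q.1 : V), q.2) ∈ L) ∧
      (∀ R : ℝ, {p | p ∈ L' ∧ ‖p.1‖ ≤ R}.Finite) ∧
      Submodule.span ℝ {v | ∃ p ∈ L', p.1 = v ∧ ‖v‖ ≤ c} = ⊤ := by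
  refine ⟨L.comap ((Submodule.span ℝ S).subtype.toAddMonoidHom.prodMap (AddMonoidHom.id G)),
    fun q => Iff.rfl, fun R => ?_, ?_⟩
  · refine Set.Finite.of_finite_image
      (f := fun q : Submodule.span ℝ S × G => ((q.1 : V), q.2)) ((hfin R).subset ?_) ?_
    · rintro _ ⟨q, ⟨hq, hqR⟩, rfl⟩
      exact ⟨hq, hqR⟩
    · intro q _ q' _ h
      simp only [Prod.mk.injEq, Subtype.coe_inj] at h
      exact Prod.ext h.1 h.2
  · rw [eq_top_iff, ← Submodule.span_span_coe_preimage (R := ℝ) (s := S)]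
    refine Submodule.span_mono fun v hv => ?_
    obtain ⟨p, hp, hpv, hvc⟩ := hS v hv
    have h : ((v : V), p.2) = p := Prod.ext hpv.symm rfl
    exact ⟨(v, p.2), show ((v : V), p.2) ∈ L from h ▸ hp, rfl, hvc⟩

theorem exists_lift_nsmul {V G : Type} [NormedAddCommGroup V] [AddCommGroup G] [DecidableEq G]
    {L : AddSubgroup (V × G)} {X : Finset G} {a : ℝ}
    (hX : ∀ x ∈ X, ∃ p ∈ L, p.2 = x ∧ ‖p.1‖ ≤ a) (j : ℕ) :
    ∀ x ∈ j • X, ∃ p ∈ L, p.2 = x ∧ ‖p.1‖ ≤ j * a := by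
  induction j with
  | zero =>
    intro x hx
    rw [zero_nsmul, Finset.mem_zero] at hx
    exact ⟨0, L.zero_mem, by simp [hx], by simp⟩
  | succ j ih =>
    intro x hx
    rw [succ_nsmul] at hx
    obtain ⟨y, hy, z, hz, rfl⟩ := Finset.mem_add.mp hx
    obtain ⟨p, hp, rfl, hpn⟩ := ih y hy
    obtain ⟨q, hq, rfl, hqn⟩ := hX z hz
    refine ⟨p + q, L.add_mem hp hq, rfl, ?_⟩
    push_cast
    rw [Prod.fst_add]
    linarith [norm_add_le p.1 q.1]

/-- Slow growth of sumsets bounds the number of independent short vectors of the graph. -/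
theorem exists_finrank_span_le (E : ℕ) {c κ : ℝ} (hc0 : 0 < c) (hc1 : c < 1 / 2) (hκ : 1 ≤ κ) :
    ∃ (c' : ℝ) (k₀ : ℕ), 0 < c' ∧ ∀ (V : Type) [NormedAddCommGroup V] [NormedSpace ℝ V]
      [FiniteDimensional ℝ V] (G : Type) [AddCommGroup G] [IsAddTorsionFree G] [DecidableEq G]
      (L : AddSubgroup (V × G)), (∀ R : ℝ, {p | p ∈ L ∧ ‖p.1‖ ≤ R}.Finite) →
      ∀ (X : Finset G) (k : ℕ), 0 ∈ X → k₀ ≤ k → (∀ p ∈ L, ‖p.1‖ ≤ c → p.2 ∈ k • X) →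
      (∀ x ∈ X, ∃ p ∈ L, p.2 = x ∧ ‖p.1‖ ≤ κ / k) →
      (∀ p ∈ L, p.2 = 0 → ‖p.1‖ < 1 → p.1 = 0) →
      (∀ k' : ℕ, 1 ≤ k' → k' ≤ k →
        ((k • X).card : ℝ) * (k' : ℝ) ^ E ≤ (k' • X).card * (k : ℝ) ^ E) →
      finrank ℝ (Submodule.span ℝ {v | ∃ p ∈ L, p.1 = v ∧ ‖v‖ ≤ c'}) ≤ E := by
  obtain ⟨C, hC1, hC⟩ := exists_reduced_basis_graph (E + 1)
  have hC0 : 0 < C := by linarith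
  have hκ0 : 0 < κ := by linarith
  set B : ℝ := 32 * (E + 1) * C * κ / c with hB
  have hB0 : 0 < B := by positivity
  obtain ⟨A, hA⟩ := exists_nat_gt (B ^ E)
  have hA0 : (0 : ℝ) < A := lt_trans (by positivity) hA
  have hA1 : (1 : ℝ) ≤ A := by exact_mod_cast (Nat.cast_pos.mp hA0 : 0 < A)
  set τ : ℝ := c / (4 * (E + 1) * A) with hτ
  have hτ0 : 0 < τ := by positivity
  have hτ4 : τ ≤ c / 4 := by
    rw [hτ]
    apply div_le_div_of_nonneg_left hc0.le (by norm_num)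
    have : (1 : ℝ) ≤ (E + 1) * A := by
      have : (1 : ℝ) ≤ E + 1 := by linarith [(Nat.cast_nonneg E : (0 : ℝ) ≤ E)]
      nlinarith
    linarith
  refine ⟨τ / C, max 1 ⌈8 * C * κ / τ⌉₊, by positivity, ?_⟩
  intro V _ _ _ G _ _ _ L hfin X k h0 hk ha hb hc hgrow
  have hk1 : 1 ≤ k := le_of_max_le_left hk
  have hkpos : (0 : ℝ) < k := by exact_mod_cast hk1
  have hkτ : 8 * C * κ ≤ k * τ := by
    have := (Nat.le_ceil _).trans (Nat.cast_le.mpr (le_of_max_le_right hk))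
    rwa [div_le_iff₀ hτ0] at this
  by_contra! hdim
  obtain ⟨T, hTsub, hTspan, hTli⟩ :=
    exists_linearIndependent ℝ {v | ∃ p ∈ L, p.1 = v ∧ ‖v‖ ≤ τ / C}
  have : Finite T := hTli.setFinite
  have := Fintype.ofFinite T
  have hTcard : E + 1 ≤ Fintype.card T := by
    rw [← hTspan, ← Subtype.range_coe (s := T), finrank_span_eq_card hTli] at hdim
    exact hdim
  obtain ⟨u⟩ : Nonempty (Fin (E + 1) ↪ T) :=
    Function.Embedding.nonempty_of_card_le (by simpa using hTcard)
  set S : Set V := Set.range fun i => (u i : V) with hS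
  have hSrank : finrank ℝ (Submodule.span ℝ S) = E + 1 := by
    have h := finrank_span_eq_card (hTli.comp u u.injective)
    rwa [Fintype.card_fin] at h
  obtain ⟨L', hL', hfin', hspan'⟩ := exists_restrict_graph (S := S) (c := τ / C) hfin (by
    rintro _ ⟨i, rfl⟩
    exact hTsub (u i).2)
  obtain ⟨r, b, -, hbL, hb0, -, hbineq, hbspan⟩ :=
    hC (Submodule.span ℝ S) G hSrank.le L' hfin'
  obtain ⟨hr, hbn⟩ := hbspan (τ / C) hspan'
  rw [hSrank] at hr
  rw [mul_div_cancel₀ _ hC0.ne'] at hbn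
  have hbpos : ∀ i, 0 < ‖(b i).1‖ := fun i => norm_pos_iff.mpr (hb0 i)
  set M : Fin r → ℕ := fun i => ⌈τ / ‖(b i).1‖⌉₊ with hM
  have hM1 : ∀ i, τ ≤ M i * ‖(b i).1‖ := fun i => by
    have := Nat.le_ceil (τ / ‖(b i).1‖)
    rwa [div_le_iff₀ (hbpos i)] at this
  have hM2 : ∀ i, M i * ‖(b i).1‖ ≤ 2 * τ := fun i => by
    have h1 := (Nat.ceil_lt_add_one (a := τ / ‖(b i).1‖) (by positivity)).le
    have h2 := mul_le_mul_of_nonneg_right h1 (hbpos i).le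
    rw [add_mul, div_mul_cancel₀ _ (hbpos i).ne'] at h2
    linarith [hbn i]
  let P : (Fin r → Fin A) → Submodule.span ℝ S × G := fun s =>
    ∑ i, (((s i : ℕ) * M i : ℕ) : ℤ) • b i
  have hPL : ∀ s, P s ∈ L' := fun s => L'.sum_mem fun i _ => L'.zsmul_mem (hbL i) _
  have hPn : ∀ s, ‖(P s).1‖ ≤ c / 2 := fun s => by
    simp only [P]
    rw [Prod.fst_sum]
    calc ‖∑ i, ((((s i : ℕ) * M i : ℕ) : ℤ) • b i).1‖
        ≤ ∑ i, ‖((((s i : ℕ) * M i : ℕ) : ℤ) • b i).1‖ := norm_sum_le _ _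
      _ ≤ ∑ _i : Fin r, A * (2 * τ) := by
        refine Finset.sum_le_sum fun i _ => ?_
        rw [Prod.smul_fst, ← Int.cast_smul_eq_zsmul ℝ, norm_smul, Real.norm_eq_abs]
        push_cast
        rw [abs_of_nonneg (by positivity), mul_assoc]
        have : ((s i : ℕ) : ℝ) ≤ A := by exact_mod_cast (s i).2.le
        exact mul_le_mul this (hM2 i) (by positivity) (by positivity)
      _ = c / 2 := by
        simp only [Finset.sum_const, Finset.card_univ, Fintype.card_fin, hr, nsmul_eq_mul, hτ]
        push_cast
        field_simp
        norm_num
  have hPsep : ∀ s s', ‖(P s).1 - (P s').1‖ < τ / C → s = s' := fun s s' hlt => by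
    by_contra hne
    obtain ⟨i, hi⟩ := Function.ne_iff.mp hne
    have h1 := hbineq (fun i => (((s i : ℕ) * M i : ℕ) : ℤ) - (((s' i : ℕ) * M i : ℕ) : ℤ)) i
    have h2 : (∑ j, ((((s j : ℕ) * M j : ℕ) : ℤ) - (((s' j : ℕ) * M j : ℕ) : ℤ)) • b j) =
        P s - P s' := by
      simp only [P, sub_smul, Finset.sum_sub_distrib]
    rw [h2, Prod.fst_sub] at h1
    have h3 : (1 : ℝ) ≤ |((s i : ℕ) : ℝ) - ((s' i : ℕ) : ℝ)| := by
      have : (1 : ℤ) ≤ |((s i : ℕ) : ℤ) - ((s' i : ℕ) : ℤ)| := by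
        refine Int.one_le_abs (sub_ne_zero.mpr ?_)
        exact_mod_cast fun h => hi (Fin.ext h)
      exact_mod_cast this
    push_cast at h1
    rw [← sub_mul, abs_mul, Nat.abs_cast, mul_assoc] at h1
    have h4 : τ ≤ C * ‖(P s).1 - (P s').1‖ := by
      refine le_trans ?_ h1
      nlinarith [hM1 i]
    rw [lt_div_iff₀ hC0] at hlt
    linarith
  set k' := ⌊k * τ / (4 * C * κ)⌋₊ with hk'
  have hk'1 : (k' : ℝ) * (κ / k) ≤ τ / (4 * C) := by
    have : (k' : ℝ) ≤ k * τ / (4 * C * κ) := Nat.floor_le (by positivity)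
    calc (k' : ℝ) * (κ / k) ≤ k * τ / (4 * C * κ) * (κ / k) := by gcongr
      _ = τ / (4 * C) := by field_simp
  have hx2 : 2 ≤ k * τ / (4 * C * κ) := by
    rw [le_div_iff₀ (by positivity)]
    linarith
  have hk'2 : (k : ℝ) ≤ B * A * k' := by
    have h1 : k * τ / (4 * C * κ) - 1 < k' := Nat.sub_one_lt_floor _
    have h2 : k * τ / (4 * C * κ) / 2 ≤ k' := by linarith
    have h3 : (k : ℝ) = B * A * (k * τ / (4 * C * κ) / 2) := by
      rw [hB, hτ]
      field_simp
      norm_num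
    calc (k : ℝ) = B * A * (k * τ / (4 * C * κ) / 2) := h3
      _ ≤ _ := by gcongr
  have hk'3 : 1 ≤ k' := Nat.le_floor (by push_cast; linarith)
  have hk'4 : k' ≤ k := by
    have h1 : (k' : ℝ) ≤ k * τ / (4 * C * κ) := Nat.floor_le (by positivity)
    have h2 : k * τ / (4 * C * κ) ≤ k := by
      rw [div_le_iff₀ (by positivity)]
      have : τ ≤ 4 * C * κ := by nlinarith
      gcongr
    exact_mod_cast h1.trans h2
  choose! q hqL hq2 hqn using exists_lift_nsmul hb k'
  have hcτ : τ / (4 * C) ≤ c / 4 := by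
    refine (div_le_self hτ0.le (by linarith)).trans hτ4
  have hcard : A ^ r * (k' • X).card ≤ (k • X).card := by
    have := Finset.card_le_card_of_injOn (s := (Finset.univ : Finset (Fin r → Fin A)) ×ˢ (k' • X))
      (t := k • X) (fun z => (P z.1).2 + z.2) ?_ ?_
    · simpa [Finset.card_product] using this
    · rintro ⟨s, y⟩ hz
      have hy : y ∈ k' • X := (Finset.mem_product.mp hz).2
      have h1 := ha (((P s).1 : V) + (q y).1, (P s).2 + (q y).2)
        (L.add_mem ((hL' _).mp (hPL s)) (hqL y hy)) (by
          have h2 : ‖((P s).1 : V)‖ ≤ c / 2 := hPn s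
          have h3 := norm_add_le ((P s).1 : V) (q y).1
          have h4 := hqn y hy
          simp only
          linarith)
      simp only [hq2 y hy] at h1
      exact h1
    · rintro ⟨s, y⟩ hz ⟨s', y'⟩ hz' heq
      have hy : y ∈ k' • X := (Finset.mem_product.mp hz).2
      have hy' : y' ∈ k' • X := (Finset.mem_product.mp hz').2
      simp only at heq
      have h1 : ((((P s).1 : V) + (q y).1) - (((P s').1 : V) + (q y').1),
          ((P s).2 + (q y).2) - ((P s').2 + (q y').2)) ∈ L :=
        L.sub_mem (L.add_mem ((hL' _).mp (hPL s)) (hqL y hy))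
          (L.add_mem ((hL' _).mp (hPL s')) (hqL y' hy'))
      have h2 := hc _ h1 (by simp only [hq2 y hy, hq2 y' hy', heq, sub_self]) (by
        have h2 : ‖((P s).1 : V)‖ ≤ c / 2 := hPn s
        have h2' : ‖((P s').1 : V)‖ ≤ c / 2 := hPn s'
        have h3 := norm_add_le ((P s).1 : V) (q y).1
        have h3' := norm_add_le ((P s').1 : V) (q y').1
        have h4 := hqn y hy
        have h4' := hqn y' hy'
        have h5 := norm_sub_le (((P s).1 : V) + (q y).1) (((P s').1 : V) + (q y').1)
        simp only
        linarith)
      simp only at h2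
      have h3 : ((P s).1 : V) - (P s').1 = (q y').1 - (q y).1 := by
        rw [sub_eq_sub_iff_add_eq_add, sub_eq_zero.mp h2, add_comm]
      have hss : s = s' := hPsep s s' (by
        have h4 : ‖(P s).1 - (P s').1‖ = ‖((P s).1 : V) - (P s').1‖ := rfl
        rw [h4, h3]
        have h5 := norm_sub_le (q y').1 (q y).1
        have h6 : τ / C = 4 * (τ / (4 * C)) := by field_simp
        have h7 : 0 < τ / (4 * C) := by positivity
        linarith [hqn y hy, hqn y' hy'])
      subst hss
      exact Prod.ext rfl (add_left_cancel heq)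
  have hg := hgrow k' hk'3 hk'4
  have hgpos : (0 : ℝ) < (k' • X).card := by
    exact_mod_cast (Finset.Nonempty.nsmul ⟨0, h0⟩ : (k' • X).Nonempty).card_pos
  have hcard' : (A : ℝ) ^ r * (k' • X).card ≤ (k • X).card := by exact_mod_cast hcard
  have hk'pos : (0 : ℝ) < k' := by exact_mod_cast hk'3
  have hfinal : (A : ℝ) ^ (E + 1) * ((k' • X).card * (k' : ℝ) ^ E) ≤
      (B ^ E * A ^ E) * ((k' • X).card * (k' : ℝ) ^ E) := by
    calc (A : ℝ) ^ (E + 1) * ((k' • X).card * (k' : ℝ) ^ E)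
        = (A : ℝ) ^ r * (k' • X).card * (k' : ℝ) ^ E := by rw [hr]; ring
      _ ≤ (k • X).card * (k' : ℝ) ^ E := by gcongr
      _ ≤ (k' • X).card * (k : ℝ) ^ E := hg
      _ ≤ (k' • X).card * (B * A * k') ^ E := by gcongr
      _ = _ := by rw [mul_pow, mul_pow]; ring
  have h8 := le_of_mul_le_mul_right hfinal (by positivity)
  rw [pow_succ, mul_comm] at h8
  exact absurd (le_of_mul_le_mul_right h8 (by positivity)) (not_le.mpr hA)

/-- An integer is a sum of `s` integers of nearly equal size. -/
theorem exists_sum_range_eq_int (n : ℤ) {s : ℕ} (hs : 0 < s) :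
    ∃ f : ℕ → ℤ, ∑ j ∈ Finset.range s, f j = n ∧ ∀ j, |(f j : ℝ)| ≤ |(n : ℝ)| / s + 1 := by
  have hs' : (0 : ℝ) < s := by exact_mod_cast hs
  refine ⟨fun j => ⌊((j + 1 : ℕ) : ℝ) * (n / s)⌋ - ⌊(j : ℝ) * (n / s)⌋, ?_, fun j => ?_⟩
  · rw [Finset.sum_range_sub (fun j : ℕ => ⌊(j : ℝ) * ((n : ℝ) / s)⌋), mul_div_cancel₀ _ hs'.ne']
    simp
  · push_cast
    rw [← abs_of_pos hs', ← abs_div, abs_of_pos hs']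
    have h1 := Int.floor_le (((j : ℝ) + 1) * (n / s))
    have h2 := Int.lt_floor_add_one (((j : ℝ) + 1) * (n / s))
    have h3 := Int.floor_le ((j : ℝ) * (n / s))
    have h4 := Int.lt_floor_add_one ((j : ℝ) * (n / s))
    have h5 := neg_abs_le ((n : ℝ) / s)
    have h6 := le_abs_self ((n : ℝ) / s)
    rw [abs_le]
    constructor <;> linarith

/-- A scale minimising the normalised growth of a polynomially growing sequence. -/
theorem exists_growth_minimizer {g : ℕ → ℝ} {D l : ℕ} (hl : 1 ≤ l) (hg : ∀ k, 1 ≤ g k)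
    (hgl : g l ≤ (l : ℝ) ^ (D + 1)) :
    ∃ k, 1 ≤ k ∧ k ≤ l ∧ l ≤ k ^ 2 ∧ ∀ k', 1 ≤ k' → k' ≤ l →
      g k * (k' : ℝ) ^ (2 * (D + 1)) ≤ g k' * (k : ℝ) ^ (2 * (D + 1)) := by
  obtain ⟨k, hk, hmin⟩ := Finset.exists_min_image (Finset.Icc 1 l)
    (fun k => g k / (k : ℝ) ^ (2 * (D + 1))) ⟨l, Finset.mem_Icc.mpr ⟨hl, le_rfl⟩⟩
  rw [Finset.mem_Icc] at hk
  have hmin' : ∀ k', 1 ≤ k' → k' ≤ l →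
      g k * (k' : ℝ) ^ (2 * (D + 1)) ≤ g k' * (k : ℝ) ^ (2 * (D + 1)) := by
    intro k' h1 h2
    have hk0 : (0 : ℝ) < k := by exact_mod_cast hk.1
    have hk'0 : (0 : ℝ) < k' := by exact_mod_cast h1
    have := hmin k' (Finset.mem_Icc.mpr ⟨h1, h2⟩)
    rwa [div_le_div_iff₀ (by positivity) (by positivity)] at this
  refine ⟨k, hk.1, hk.2, ?_, hmin'⟩
  have h1 := hmin' l hl le_rfl
  have hl0 : (0 : ℝ) < l := by exact_mod_cast hl
  have h2 : (l : ℝ) ^ (D + 1) * (l : ℝ) ^ (D + 1) ≤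
      (l : ℝ) ^ (D + 1) * ((k : ℝ) ^ 2) ^ (D + 1) := by
    calc (l : ℝ) ^ (D + 1) * (l : ℝ) ^ (D + 1) = 1 * (l : ℝ) ^ (2 * (D + 1)) := by ring
      _ ≤ g k * (l : ℝ) ^ (2 * (D + 1)) := by gcongr; exact hg k
      _ ≤ g l * (k : ℝ) ^ (2 * (D + 1)) := h1
      _ ≤ (l : ℝ) ^ (D + 1) * (k : ℝ) ^ (2 * (D + 1)) := by gcongr
      _ = _ := by rw [pow_mul]
  have h3 := le_of_mul_le_mul_left h2 (by positivity)
  have h4 := le_of_pow_le_pow_left₀ (Nat.succ_ne_zero D) (by positivity) h3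
  exact_mod_cast h4

/-- A symmetric set of integer vectors whose `l`-fold sumset has polynomial size in `l` is
contained in a proper symmetric progression of bounded rank, of size `O(|lX| / l ^ r)`. -/
theorem exists_gap_of_polynomial_growth (D : ℕ) : ∃ (E : ℕ) (K : ℝ) (l₀ : ℕ), 0 < K ∧
    ∀ (m : ℕ) (X : Finset (Fin m → ℤ)) (l : ℕ), 0 ∈ X → -X = X → l₀ ≤ l →
      ((l • X).card : ℝ) ≤ (l : ℝ) ^ D →
      ∃ (r : ℕ) (g : Fin r → Fin m → ℤ) (M : Fin r → ℕ), r ≤ E ∧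
        (∀ x ∈ X, ∃ n : Fin r → ℤ, (∀ i, |n i| ≤ M i) ∧ x = ∑ i, n i • g i) ∧
        (∀ n n' : Fin r → ℤ, (∀ i, |n i| ≤ M i) → (∀ i, |n' i| ≤ M i) →
          ∑ i, n i • g i = ∑ i, n' i • g i → n = n') ∧
        (∏ i, (2 * (M i : ℝ) + 1)) * (l : ℝ) ^ r ≤ K * (l • X).card := by
  set E := 2 * (D + 1) with hE
  obtain ⟨c, κ, k₁, hc0, hc1, hκ, hgraph⟩ :=
    exists_graph_of_doubling (K := 4 ^ E) (one_le_pow₀ (by norm_num))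
  obtain ⟨c', k₂, hc'0, hdim⟩ := exists_finrank_span_le E hc0 hc1 hκ
  obtain ⟨C, hC1, hC⟩ := exists_reduced_basis_graph E
  have hC0 : 0 < C := by linarith
  have hκ0 : 0 < κ := by linarith
  set c'' : ℝ := min c' (c / (2 * (E + 1) * C)) with hc''
  have hc''0 : 0 < c'' := lt_min hc'0 (by positivity)
  obtain ⟨K, l₁, hK, hgap⟩ := exists_gap_of_graph E (c / (4 * (E + 1) * C * κ)) (by positivity)
  set k₀ := max (max k₁ k₂) (max 8 ⌈κ / c''⌉₊) with hk₀
  refine ⟨E, K, max (max 1 l₁) (k₀ ^ 2), hK, ?_⟩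
  intro m X l h0 hneg hl hlX
  have hl1 : 1 ≤ l := (le_max_left _ _).trans ((le_max_left _ _).trans hl)
  have hne : ∀ i : ℕ, (i • X).Nonempty := fun i => Finset.Nonempty.nsmul ⟨0, h0⟩
  obtain ⟨k, hk1, hkl, hlk, hmin⟩ := exists_growth_minimizer (g := fun i => ((i • X).card : ℝ))
    (D := D) hl1 (fun i => by exact_mod_cast (hne i).card_pos) (hlX.trans (by
      have : (1 : ℝ) ≤ l := by exact_mod_cast hl1
      exact pow_le_pow_right₀ this (Nat.le_succ D)))
  have hk : k₀ ≤ k := by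
    refine le_of_not_gt fun h => ?_
    have h1 : k ^ 2 < k₀ ^ 2 := Nat.pow_lt_pow_left h two_ne_zero
    have h2 : k₀ ^ 2 ≤ l := (le_max_right _ _).trans hl
    omega
  have hk₁ : k₁ ≤ k := ((le_max_left _ _).trans (le_max_left _ _)).trans hk
  have hk₂ : k₂ ≤ k := ((le_max_right _ _).trans (le_max_left _ _)).trans hk
  have hk8 : 8 ≤ k := ((le_max_left _ _).trans (le_max_right _ _)).trans hk
  have hkpos : (0 : ℝ) < k := by exact_mod_cast hk1
  have hκk : κ / k ≤ c'' := by
    have h1 : ⌈κ / c''⌉₊ ≤ k := ((le_max_right _ _).trans (le_max_right _ _)).trans hk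
    have h2 := (Nat.le_ceil (κ / c'')).trans (Nat.cast_le.mpr h1)
    rw [div_le_iff₀ hc''0] at h2
    rw [div_le_iff₀ hkpos]
    linarith
  obtain ⟨V, _, _, _, L, hfin, ha, hb, hc⟩ := hgraph m X k h0 hneg hk₁ (by
    have h1 := hmin (k / 8) (by omega) (by omega)
    have h2 : (k : ℝ) ≤ 16 * (k / 8 : ℕ) := by
      have : k ≤ 16 * (k / 8) := by omega
      exact_mod_cast this
    have h3 : (0 : ℝ) < (k / 8 : ℕ) := by
      have : 0 < k / 8 := by omega
      exact_mod_cast this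
    have h4 : ((k • X).card : ℝ) * ((k / 8 : ℕ) : ℝ) ^ E ≤
        (4 ^ E) ^ 2 * ((k / 8) • X).card * ((k / 8 : ℕ) : ℝ) ^ E := by
      calc ((k • X).card : ℝ) * ((k / 8 : ℕ) : ℝ) ^ E ≤ ((k / 8) • X).card * (k : ℝ) ^ E := h1
        _ ≤ ((k / 8) • X).card * (16 * (k / 8 : ℕ)) ^ E := by gcongr
        _ = _ := by
          have e : (16 : ℝ) ^ E = (4 ^ E) ^ 2 := by
            rw [pow_right_comm (4 : ℝ) E 2, show (4 : ℝ) ^ 2 = 16 by norm_num]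
          rw [mul_pow, e, mul_left_comm, mul_assoc]
    exact le_of_mul_le_mul_right h4 (by positivity))
  have hrank := hdim V (Fin m → ℤ) L hfin X k h0 hk₂ ha hb hc fun k' h1 h2 =>
    hmin k' h1 (h2.trans hkl)
  set S : Set V := {v | ∃ p ∈ L, p.1 = v ∧ ‖v‖ ≤ c''} with hS
  obtain ⟨L', hL', hfin', hspan'⟩ := exists_restrict_graph (S := S) hfin fun v hv => hv
  have hrank' : finrank ℝ (Submodule.span ℝ S) ≤ E := by
    refine (Submodule.finrank_mono (Submodule.span_mono ?_)).trans hrank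
    rintro v ⟨p, hp, hpv, hv⟩
    exact ⟨p, hp, hpv, hv.trans (min_le_left _ _)⟩
  obtain ⟨r, b, hr, hbL, -, hbgen, hbineq, hbspan⟩ :=
    hC (Submodule.span ℝ S) (Fin m → ℤ) hrank' L' hfin'
  obtain ⟨-, hbn⟩ := hbspan c'' hspan'
  have hrE : (r : ℝ) ≤ E := by exact_mod_cast hr.trans hrank'
  have hE0 : (0 : ℝ) ≤ E := Nat.cast_nonneg _
  refine hgap (Submodule.span ℝ S) (Fin m → ℤ) hrank' L' hfin' X (l • X) l (κ / k)
    ((le_max_right _ _).trans ((le_max_left _ _).trans hl)) (by positivity) ?_ ?_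
  · intro x hx
    obtain ⟨p, hp, rfl, hpn⟩ := hb x hx
    have hpS : p.1 ∈ Submodule.span ℝ S :=
      Submodule.subset_span ⟨p, hp, rfl, hpn.trans hκk⟩
    exact ⟨(⟨p.1, hpS⟩, p.2), (hL' _).mpr hp, rfl, hpn⟩
  · intro q hq hqn
    set s := l / k with hs
    have hs1 : 1 ≤ s := by rw [hs, Nat.one_le_div_iff hk1]; exact hkl
    have hspos : (0 : ℝ) < s := by exact_mod_cast hs1
    have hls : (l : ℝ) ≤ 2 * s * k := by
      have h1 : l < k * (s + 1) := Nat.lt_mul_div_succ l hk1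
      have h2 : l ≤ 2 * s * k := by nlinarith
      exact_mod_cast h2
    have hqn' : C * ‖q.1‖ ≤ s * (c / (2 * (E + 1))) := by
      calc C * ‖q.1‖ ≤ C * (c / (4 * (E + 1) * C * κ) * l * (κ / k)) := by gcongr
        _ = l / (2 * k) * (c / (2 * (E + 1))) := by field_simp; norm_num
        _ ≤ s * (c / (2 * (E + 1))) := by
          gcongr
          rw [div_le_iff₀ (by positivity)]
          linarith
    obtain ⟨n, rfl⟩ := hbgen q hq
    choose f hfsum hfle using fun i => exists_sum_range_eq_int (n i) hs1
    have hqsum : ∑ i, n i • b i = ∑ j ∈ Finset.range s, ∑ i, f i j • b i := by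
      rw [Finset.sum_comm]
      refine Finset.sum_congr rfl fun i _ => ?_
      rw [← Finset.sum_smul, hfsum]
    have hmem : ∀ j, (∑ i, f i j • b i).2 ∈ k • X := by
      intro j
      have hj : ∑ i, f i j • b i ∈ L' := L'.sum_mem fun i _ => L'.zsmul_mem (hbL i) _
      refine ha _ ((hL' _).mp hj) ?_
      change ‖(∑ i, f i j • b i).1‖ ≤ c
      rw [Prod.fst_sum]
      calc ‖∑ i, (f i j • b i).1‖ ≤ ∑ i, ‖(f i j • b i).1‖ := norm_sum_le _ _
        _ ≤ ∑ _i : Fin r, c / (E + 1) := by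
          refine Finset.sum_le_sum fun i _ => ?_
          rw [Prod.smul_fst, ← Int.cast_smul_eq_zsmul ℝ, norm_smul, Real.norm_eq_abs]
          have h1 := mul_le_mul_of_nonneg_right (hfle i j) (norm_nonneg (b i).1)
          have h2 := (hbineq n i).trans hqn'
          have h3 : |(n i : ℝ)| / s * ‖(b i).1‖ ≤ c / (2 * (E + 1)) := by
            rw [div_mul_eq_mul_div, div_le_iff₀ hspos]
            linarith
          have h4 : ‖(b i).1‖ ≤ c / (2 * (E + 1)) := by
            calc ‖(b i).1‖ ≤ C * c'' := hbn i
              _ ≤ C * (c / (2 * (E + 1) * C)) := by gcongr; exact min_le_right _ _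
              _ = c / (2 * (E + 1)) := by field_simp
          have h5 : c / (E + 1) = c / (2 * (E + 1)) + c / (2 * (E + 1)) := by field_simp; ring
          linarith
        _ = r * (c / (E + 1)) := by simp
        _ ≤ E * (c / (E + 1)) := by gcongr
        _ ≤ c := by
          rw [mul_div_assoc', div_le_iff₀ (by positivity)]
          nlinarith
    have hsum : ∀ t : ℕ, (∑ j ∈ Finset.range t, ∑ i, f i j • b i).2 ∈ (t * k) • X := by
      intro t
      induction t with
      | zero => simp
      | succ t ih =>
        rw [Finset.sum_range_succ, Prod.snd_add, add_mul, one_mul, add_nsmul]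
        exact Finset.add_mem_add ih (hmem t)
    rw [hqsum]
    exact Finset.nsmul_subset_nsmul_right h0 (Nat.div_mul_le_self l k) (hsum s)

theorem norm_one_sub_addChar_sq {Γ : Type} [AddCommGroup Γ] [Finite Γ] (χ : AddChar Γ ℂ) (x : Γ) :
    ‖1 - χ x‖ ^ 2 = 2 * (1 - (χ x).re) := by
  have h := AddChar.norm_apply χ x
  have h1 : (χ x).re ^ 2 + (χ x).im ^ 2 = 1 := by
    rw [← one_pow 2, ← h, ← Complex.normSq_eq_norm_sq, Complex.normSq_apply]
    ring
  rw [← Complex.normSq_eq_norm_sq, Complex.normSq_apply]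
  simp only [Complex.sub_re, Complex.one_re, Complex.sub_im, Complex.one_im]
  linarith

theorem norm_one_add_addChar_le {Γ : Type} [AddCommGroup Γ] [Finite Γ] (χ : AddChar Γ ℂ) (x : Γ) :
    ‖1 + χ x‖ ≤ 2 * Real.exp (-(1 - (χ x).re) / 4) := by
  have h := AddChar.norm_apply χ x
  have h1 : (χ x).re ^ 2 + (χ x).im ^ 2 = 1 := by
    rw [← one_pow 2, ← h, ← Complex.normSq_eq_norm_sq, Complex.normSq_apply]
    ring
  refine le_of_sq_le_sq ?_ (by positivity)
  rw [mul_pow, ← Real.exp_nat_mul, ← Complex.normSq_eq_norm_sq, Complex.normSq_apply]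
  simp only [Complex.add_re, Complex.one_re, Complex.add_im, Complex.one_im]
  have h2 := Real.add_one_le_exp (((2 : ℕ) : ℝ) * (-(1 - (χ x).re) / 4))
  push_cast at h2 ⊢
  linarith

/-- The number of subset sums equal to `t` is bounded by the Fourier transform. -/
theorem card_subset_sum_le {Γ : Type} [AddCommGroup Γ] [Fintype Γ] [DecidableEq Γ] {n : ℕ}
    (z : Fin n → Γ) (t : Γ) :
    (Fintype.card Γ : ℝ) * (Finset.univ.filter fun s : Finset (Fin n) => ∑ i ∈ s, z i = t).card ≤
      2 ^ n * ∑ χ : AddChar Γ ℂ, Real.exp (-(∑ i, (1 - (χ (z i)).re)) / 4) := by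
  have h1 : ((Fintype.card Γ : ℝ) *
      (Finset.univ.filter fun s : Finset (Fin n) => ∑ i ∈ s, z i = t).card : ℂ) =
      ∑ χ : AddChar Γ ℂ, χ (-t) * ∏ i, (1 + χ (z i)) := by
    calc ((Fintype.card Γ : ℝ) *
        (Finset.univ.filter fun s : Finset (Fin n) => ∑ i ∈ s, z i = t).card : ℂ)
        = ∑ s : Finset (Fin n), ∑ χ : AddChar Γ ℂ, χ (∑ i ∈ s, z i - t) := by
          simp only [AddChar.sum_apply_eq_ite, sub_eq_zero]
          rw [← Finset.sum_filter]
          simp [mul_comm]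
      _ = _ := by
          rw [Finset.sum_comm]
          refine Finset.sum_congr rfl fun χ _ => ?_
          rw [Finset.prod_one_add, Finset.powerset_univ, Finset.mul_sum]
          refine Finset.sum_congr rfl fun s _ => ?_
          rw [sub_eq_add_neg, AddChar.map_add_eq_mul, mul_comm]
          congr 1
          exact map_prod χ.toMonoidHom (fun i => Multiplicative.ofAdd (z i)) s
  calc (Fintype.card Γ : ℝ) *
        (Finset.univ.filter fun s : Finset (Fin n) => ∑ i ∈ s, z i = t).card
      = ‖∑ χ : AddChar Γ ℂ, χ (-t) * ∏ i, (1 + χ (z i))‖ := by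
        rw [← h1]
        simp
    _ ≤ ∑ χ : AddChar Γ ℂ, 2 ^ n * Real.exp (-(∑ i, (1 - (χ (z i)).re)) / 4) := by
        refine (norm_sum_le _ _).trans (Finset.sum_le_sum fun χ _ => ?_)
        rw [norm_mul, AddChar.norm_apply, one_mul, norm_prod]
        calc ∏ i, ‖1 + χ (z i)‖ ≤ ∏ i, (2 * Real.exp (-(1 - (χ (z i)).re) / 4)) :=
              Finset.prod_le_prod (fun _ _ => norm_nonneg _) fun i _ =>
                norm_one_add_addChar_le χ (z i)
          _ = _ := by
              rw [Finset.prod_mul_distrib, Finset.prod_const, Finset.card_univ, Fintype.card_fin,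
                ← Real.exp_sum, ← Finset.sum_div, Finset.sum_neg_distrib]
    _ = _ := by rw [Finset.mul_sum]

/-- If the average of `exp (-F / 4)` is at least `ρ`, some sublevel set of `F` is large. -/
theorem exists_large_sublevel {T : Type} [Fintype T] {F : T → ℝ} (hF : ∀ χ, 0 ≤ F χ) {ρ N : ℝ}
    (hρ : 0 < ρ) (hN : 0 < N) (h : ρ * N ≤ ∑ χ, Real.exp (-F χ / 4)) :
    ∃ m : ℕ, 1 ≤ m ∧
      ρ / 20 * Real.exp (m / 8) * N ≤ (Finset.univ.filter fun χ => F χ ≤ m).card := by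
  by_contra! hlt
  obtain ⟨M, hM⟩ : ∃ M : ℕ, ∀ χ, F χ ≤ M := by
    obtain ⟨B, hB⟩ := (Set.finite_range F).bddAbove
    exact ⟨⌈B⌉₊, fun χ => (hB ⟨χ, rfl⟩).trans (Nat.le_ceil B)⟩
  set q : ℝ := Real.exp (-(1 / 8)) with hq
  have hq0 : 0 < q := Real.exp_pos _
  have hq1 : q ≤ 8 / 9 := by
    have h1 : (9 : ℝ) / 8 ≤ Real.exp (1 / 8) := by linarith [Real.add_one_le_exp (1 / 8 : ℝ)]
    rw [hq, Real.exp_neg, inv_le_comm₀ (Real.exp_pos _) (by norm_num)]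
    linarith
  have hexp : Real.exp (1 / 8) ≤ 2 := by
    have h1 : Real.exp (1 / 8) = q⁻¹ := by rw [hq, Real.exp_neg, inv_inv]
    have h2 : (7 : ℝ) / 8 ≤ q := by linarith [Real.add_one_le_exp (-(1 / 8) : ℝ)]
    rw [h1, inv_le_comm₀ hq0 (by norm_num)]
    linarith
  have h1 : ∑ χ, Real.exp (-F χ / 4) ≤ ∑ χ, ∑ j ∈ Finset.range (M + 1),
      if F χ ≤ (j + 1 : ℕ) then Real.exp (-(j : ℝ) / 4) else 0 := by
    refine Finset.sum_le_sum fun χ _ => ?_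
    have h2 : ⌊F χ⌋₊ ∈ Finset.range (M + 1) := by
      rw [Finset.mem_range, Nat.lt_succ_iff]
      exact Nat.floor_le_of_le (hM χ)
    have h3 : F χ ≤ (⌊F χ⌋₊ + 1 : ℕ) := by
      push_cast
      exact (Nat.lt_floor_add_one _).le
    refine le_trans ?_ (Finset.single_le_sum (fun j _ => ?_) h2)
    · rw [if_pos h3]
      apply Real.exp_le_exp.mpr
      linarith [Nat.floor_le (hF χ)]
    · split_ifs
      · positivity
      · exact le_rfl
  have h2 : ∑ χ, ∑ j ∈ Finset.range (M + 1),
      (if F χ ≤ (j + 1 : ℕ) then Real.exp (-(j : ℝ) / 4) else 0) ≤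
      ∑ j ∈ Finset.range (M + 1), ρ / 20 * N * 2 * q ^ j := by
    rw [Finset.sum_comm]
    refine Finset.sum_le_sum fun j _ => ?_
    rw [← Finset.sum_filter, Finset.sum_const, nsmul_eq_mul]
    have h3 := (hlt (j + 1) (Nat.succ_le_succ (Nat.zero_le j))).le
    calc _ ≤ ρ / 20 * Real.exp ((j + 1 : ℕ) / 8) * N * Real.exp (-(j : ℝ) / 4) := by gcongr
      _ = ρ / 20 * N * Real.exp (1 / 8) * q ^ j := by
        have e : Real.exp ((j + 1 : ℕ) / 8) * Real.exp (-(j : ℝ) / 4) =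
            Real.exp (1 / 8) * q ^ j := by
          rw [hq, ← Real.exp_nat_mul, ← Real.exp_add, ← Real.exp_add]
          push_cast
          ring_nf
        linear_combination ρ / 20 * N * e
      _ ≤ _ := by gcongr
  have h3 : ∑ j ∈ Finset.range (M + 1), q ^ j ≤ 9 := by
    have h4 := mul_neg_geom_sum q (M + 1)
    have h5 : 0 < q ^ (M + 1) := by positivity
    have h6 : 0 ≤ ∑ j ∈ Finset.range (M + 1), q ^ j := by positivity
    nlinarith
  rw [← Finset.mul_sum] at h2
  have h4 : ρ / 20 * N * 2 * ∑ j ∈ Finset.range (M + 1), q ^ j ≤ ρ / 20 * N * 2 * 9 := by gcongr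
  have h5 : 0 < ρ * N := by positivity
  linarith

theorem sum_norm_sum_addChar_sq {Γ : Type} [AddCommGroup Γ] [Fintype Γ]
    (S : Finset (AddChar Γ ℂ)) :
    ∑ w : Γ, ‖∑ χ ∈ S, χ w‖ ^ 2 = (Fintype.card Γ : ℝ) * S.card := by
  classical
  have : ((∑ w : Γ, ‖∑ χ ∈ S, χ w‖ ^ 2 : ℝ) : ℂ) = (Fintype.card Γ : ℂ) * S.card := by
    push_cast
    calc ∑ w : Γ, (‖∑ χ ∈ S, χ w‖ : ℂ) ^ 2
        = ∑ w : Γ, ∑ χ ∈ S, ∑ ψ ∈ S, (χ - ψ) w := by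
          refine Finset.sum_congr rfl fun w _ => ?_
          rw [← Complex.mul_conj', map_sum, Finset.sum_mul_sum]
          simp only [AddChar.sub_apply, AddChar.map_neg_eq_conj]
      _ = ∑ χ ∈ S, ∑ ψ ∈ S, ∑ w : Γ, (χ - ψ) w := by
          rw [Finset.sum_comm]
          exact Finset.sum_congr rfl fun x _ => Finset.sum_comm
      _ = _ := by
          simp only [AddChar.sum_eq_ite, sub_eq_zero]
          simp [mul_comm]
  exact_mod_cast this

/-- If all elements of `X` are close to `1` on average over `S`, the iterated sumset is small. -/
theorem card_nsmul_le_of_sum_sq_le {Γ : Type} [AddCommGroup Γ] [Fintype Γ] [DecidableEq Γ]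
    {S : Finset (AddChar Γ ℂ)} (hS : S.Nonempty) {X : Finset Γ} {q : ℝ}
    (hX : ∀ x ∈ X, ∑ χ ∈ S, ‖1 - χ x‖ ^ 2 ≤ q) {k : ℕ} (hk : 1 ≤ k)
    (hkq : k ^ 2 * q ≤ S.card) : ((k • X).card : ℝ) * S.card ≤ 4 * Fintype.card Γ := by
  have hind : ∀ j : ℕ, 1 ≤ j → ∀ w ∈ j • X, ∑ χ ∈ S, ‖1 - χ w‖ ^ 2 ≤ j ^ 2 * q := by
    intro j hj
    induction j, hj using Nat.le_induction with
    | base =>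
      intro w hw
      rw [one_nsmul] at hw
      simpa using hX w hw
    | succ j hj ih =>
      intro w hw
      rw [succ_nsmul] at hw
      obtain ⟨x, hx, y, hy, rfl⟩ := Finset.mem_add.mp hw
      have hj0 : (0 : ℝ) < j := by exact_mod_cast hj
      have h1 : ∀ χ : AddChar Γ ℂ, j * ‖1 - χ (x + y)‖ ^ 2 ≤
          (j + 1) * ‖1 - χ x‖ ^ 2 + j * (j + 1) * ‖1 - χ y‖ ^ 2 := by
        intro χ
        have h2 : ‖1 - χ (x + y)‖ ≤ ‖1 - χ x‖ + ‖1 - χ y‖ := by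
          calc ‖1 - χ (x + y)‖ = ‖(1 - χ x) + χ x * (1 - χ y)‖ := by
                rw [AddChar.map_add_eq_mul]
                ring_nf
            _ ≤ ‖1 - χ x‖ + ‖χ x * (1 - χ y)‖ := norm_add_le _ _
            _ = _ := by rw [norm_mul, AddChar.norm_apply, one_mul]
        have h3 : ‖1 - χ (x + y)‖ ^ 2 ≤ (‖1 - χ x‖ + ‖1 - χ y‖) ^ 2 := by gcongr
        nlinarith [sq_nonneg (‖1 - χ x‖ - j * ‖1 - χ y‖)]
      have h2 : j * ∑ χ ∈ S, ‖1 - χ (x + y)‖ ^ 2 ≤ (j + 1) * (j ^ 2 * q) + j * (j + 1) * q := by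
        calc j * ∑ χ ∈ S, ‖1 - χ (x + y)‖ ^ 2
            ≤ (j + 1) * ∑ χ ∈ S, ‖1 - χ x‖ ^ 2 + j * (j + 1) * ∑ χ ∈ S, ‖1 - χ y‖ ^ 2 := by
              rw [Finset.mul_sum, Finset.mul_sum, Finset.mul_sum, ← Finset.sum_add_distrib]
              exact Finset.sum_le_sum fun χ _ => h1 χ
          _ ≤ _ := by
              gcongr
              · exact ih x hx
              · exact hX y hy
      push_cast
      refine le_of_mul_le_mul_left (h2.trans (le_of_eq ?_)) hj0
      ring
  have hSpos : (0 : ℝ) < S.card := by exact_mod_cast hS.card_pos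
  have hlow : ∀ w ∈ k • X, (S.card : ℝ) ^ 2 / 4 ≤ ‖∑ χ ∈ S, χ w‖ ^ 2 := by
    intro w hw
    have h1 := (hind k hk w hw).trans hkq
    simp only [norm_one_sub_addChar_sq] at h1
    rw [← Finset.mul_sum, Finset.sum_sub_distrib] at h1
    have h2 : (∑ χ ∈ S, χ w).re = ∑ χ ∈ S, (χ w).re := Complex.re_sum _ _
    have h3 := Complex.re_le_norm (∑ χ ∈ S, χ w)
    have h4 : (S.card : ℝ) / 2 ≤ ‖∑ χ ∈ S, χ w‖ := by
      simp only [Finset.sum_const, nsmul_eq_mul, mul_one] at h1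
      linarith
    calc (S.card : ℝ) ^ 2 / 4 = (S.card / 2 : ℝ) ^ 2 := by ring
      _ ≤ _ := by gcongr
  have hsum : ((k • X).card : ℝ) * (S.card ^ 2 / 4) ≤ Fintype.card Γ * S.card := by
    rw [← sum_norm_sum_addChar_sq, ← nsmul_eq_mul, ← Finset.sum_const]
    exact (Finset.sum_le_sum hlow).trans
      (Finset.sum_le_sum_of_subset_of_nonneg (Finset.subset_univ _) fun _ _ _ => by positivity)
  refine le_of_mul_le_mul_right ?_ hSpos
  linarith

/-- Halász-type structure theorem: if many subset sums coincide, most of the summands generate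
small iterated sumsets. -/
theorem exists_small_sumset {Γ : Type} [AddCommGroup Γ] [Fintype Γ] [DecidableEq Γ] {n : ℕ}
    (z : Fin n → Γ) (t : Γ) {ρ : ℝ} (hρ : 0 < ρ) (hz : ρ * 2 ^ n ≤
      (Finset.univ.filter fun s : Finset (Fin n) => ∑ i ∈ s, z i = t).card) {n' : ℕ}
    (hn' : 0 < n') :
    ∃ (m : ℕ) (I : Finset (Fin n)), 1 ≤ m ∧ ρ * Real.exp (m / 8) ≤ 20 ∧ n ≤ I.card + n' ∧
      ∀ X : Finset Γ, (∀ x ∈ X, x = 0 ∨ ∃ i ∈ I, x = z i ∨ x = -z i) →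
        ∀ k : ℕ, 1 ≤ k → 2 * k ^ 2 * m ≤ n' →
          ((k • X).card : ℝ) * ρ * Real.exp (m / 8) ≤ 80 := by
  have hΓ : (0 : ℝ) < Fintype.card Γ := by exact_mod_cast Fintype.card_pos
  have hre : ∀ (χ : AddChar Γ ℂ) x, 0 ≤ 1 - (χ x).re := fun χ x => by
    have := (Complex.re_le_norm (χ x)).trans_eq (AddChar.norm_apply χ x)
    linarith
  have havg : ρ * Fintype.card Γ ≤
      ∑ χ : AddChar Γ ℂ, Real.exp (-(∑ i, (1 - (χ (z i)).re)) / 4) := by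
    have h1 := card_subset_sum_le z t
    have h2 := mul_le_mul_of_nonneg_left hz hΓ.le
    have h3 : (0 : ℝ) < 2 ^ n := by positivity
    refine le_of_mul_le_mul_left (le_trans (le_of_eq ?_) (h2.trans h1)) h3
    ring
  obtain ⟨m, hm, hS⟩ := exists_large_sublevel
    (F := fun χ : AddChar Γ ℂ => ∑ i, (1 - (χ (z i)).re))
    (fun χ => Finset.sum_nonneg fun i _ => hre χ (z i)) hρ hΓ havg
  set S := Finset.univ.filter fun χ : AddChar Γ ℂ => ∑ i, (1 - (χ (z i)).re) ≤ m with hSdef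
  have hSpos : (0 : ℝ) < S.card := lt_of_lt_of_le (by positivity) hS
  have hm0 : (0 : ℝ) < m := by exact_mod_cast hm
  have hn'0 : (0 : ℝ) < n' := by exact_mod_cast hn'
  have hSle : (S.card : ℝ) ≤ Fintype.card Γ := by
    rw [← AddChar.card_eq]
    exact_mod_cast Finset.card_le_univ S
  set I := Finset.univ.filter fun i => ∑ χ ∈ S, (1 - (χ (z i)).re) ≤ m / n' * S.card with hI
  refine ⟨m, I, hm, ?_, ?_, ?_⟩
  · have h1 := hS.trans hSle
    have h2 : ρ / 20 * Real.exp (m / 8) ≤ 1 := le_of_mul_le_mul_right (by linarith) hΓ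
    linarith
  · have h1 : ∑ i, ∑ χ ∈ S, (1 - (χ (z i)).re) ≤ m * S.card := by
      rw [Finset.sum_comm]
      calc _ ≤ ∑ _χ ∈ S, (m : ℝ) := Finset.sum_le_sum fun χ hχ => (Finset.mem_filter.mp hχ).2
        _ = _ := by simp [mul_comm]
    have h2 : (Iᶜ.card : ℝ) * (m / n' * S.card) ≤ m * S.card := by
      refine le_trans ?_ h1
      rw [← nsmul_eq_mul, ← Finset.sum_const]
      refine (Finset.sum_le_sum fun i hi => ?_).trans
        (Finset.sum_le_sum_of_subset_of_nonneg (Finset.subset_univ Iᶜ) fun i _ _ =>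
          Finset.sum_nonneg fun χ _ => hre χ (z i))
      have h3 : i ∉ I := Finset.mem_compl.mp hi
      simp only [hI, Finset.mem_filter, Finset.mem_univ, true_and, not_le] at h3
      exact h3.le
    have h3 : (Iᶜ.card : ℝ) ≤ n' := by
      have h4 : (Iᶜ.card : ℝ) * (m / n' * S.card) = Iᶜ.card / n' * (m * S.card) := by
        field_simp
      rw [h4] at h2
      have h5 : (Iᶜ.card : ℝ) / n' ≤ 1 := le_of_mul_le_mul_right (by linarith)
        (by positivity : (0 : ℝ) < m * S.card)
      rwa [div_le_one hn'0] at h5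
    have h4 : Iᶜ.card ≤ n' := by exact_mod_cast h3
    have h5 := Finset.card_compl_add_card I
    rw [Fintype.card_fin] at h5
    omega
  · intro X hX k hk hkm
    have hkm' : 2 * (k : ℝ) ^ 2 * m ≤ n' := by exact_mod_cast hkm
    have hpm : ∀ i ∈ I, ∑ χ ∈ S, ‖1 - χ (z i)‖ ^ 2 ≤ 2 * (m / n' * S.card) := by
      intro i hi
      simp only [norm_one_sub_addChar_sq]
      rw [← Finset.mul_sum]
      linarith [(Finset.mem_filter.mp hi).2]
    have h1 := card_nsmul_le_of_sum_sq_le (S := S) (X := X) (q := 2 * (m / n' * S.card))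
      (Finset.card_pos.mp (by exact_mod_cast hSpos)) (fun x hx => by
        rcases hX x hx with rfl | ⟨i, hi, rfl | rfl⟩
        · simp only [AddChar.map_zero_eq_one, sub_self, norm_zero]
          simp
          positivity
        · exact hpm i hi
        · refine le_of_eq_of_le (Finset.sum_congr rfl fun χ _ => ?_) (hpm i hi)
          rw [norm_one_sub_addChar_sq, norm_one_sub_addChar_sq, AddChar.map_neg_eq_conj,
            Complex.conj_re]) hk (by
        have e : (k : ℝ) ^ 2 * (2 * (m / n' * S.card)) = 2 * k ^ 2 * m / n' * S.card := by ring
        rw [e]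
        exact mul_le_of_le_one_left hSpos.le ((div_le_one hn'0).mpr hkm'))
    have h2 : ((k • X).card : ℝ) * (ρ / 20 * Real.exp (m / 8) * Fintype.card Γ) ≤
        4 * Fintype.card Γ := (mul_le_mul_of_nonneg_left hS (Nat.cast_nonneg _)).trans h1
    have h3 : ((k • X).card : ℝ) * (ρ / 20 * Real.exp (m / 8)) ≤ 4 :=
      le_of_mul_le_mul_right (by linarith) hΓ
    linarith

theorem exists_small_sumset_int {ι : Type} [Fintype ι] {n : ℕ} (z : Fin n → ι → ℤ) (t : ι → ℤ)
    {ρ : ℝ} (hρ : 0 < ρ)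
    (hz : ρ * 2 ^ n ≤ (Finset.univ.filter fun s : Finset (Fin n) => ∑ i ∈ s, z i = t).card)
    {n' : ℕ} (hn' : 0 < n') :
    ∃ (m : ℕ) (I : Finset (Fin n)), 1 ≤ m ∧ ρ * Real.exp (m / 8) ≤ 20 ∧ n ≤ I.card + n' ∧
      ∀ X : Finset (ι → ℤ), (∀ x ∈ X, x = 0 ∨ ∃ i ∈ I, x = z i ∨ x = -z i) →
        ∀ k, 1 ≤ k → 2 * k ^ 2 * m ≤ n' →
          ((k • X).card : ℝ) * ρ * Real.exp (m / 8) ≤ 80 := by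
  classical
  set W : Finset (ι → ℤ) :=
    insert 0 (Finset.univ.image z ∪ Finset.univ.image fun i => -z i) with hW
  obtain ⟨Γ, hΓ₁, hΓ₂, φ, hφ⟩ := exists_injOn_finite (n' • W).finite_toSet
  have hz' : ρ * 2 ^ n ≤
      (Finset.univ.filter fun s : Finset (Fin n) => ∑ i ∈ s, φ (z i) = φ t).card := by
    refine hz.trans (Nat.cast_le.2 (Finset.card_le_card fun s hs => ?_))
    simp only [Finset.mem_filter, Finset.mem_univ, true_and] at hs ⊢
    rw [← hs, map_sum]
  obtain ⟨m, I, hm, hm', hI, h⟩ := exists_small_sumset (fun i => φ (z i)) (φ t) hρ hz' hn'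
  refine ⟨m, I, hm, hm', hI, fun X hX k hk hkm => ?_⟩
  have hXW : X ⊆ W := by
    intro x hx
    rcases hX x hx with rfl | ⟨i, -, rfl | rfl⟩ <;> simp [hW]
  have hkn : k ≤ n' := by nlinarith [Nat.mul_le_mul hk hk, Nat.mul_le_mul (Nat.le_refl (k ^ 2)) hm]
  have hsub : k • X ⊆ n' • W := Finset.nsmul_subset_nsmul hXW (by simp [hW]) hkn
  have hcard : (k • X).card = (k • X.image φ).card := by
    rw [← Finset.image_nsmul, Finset.card_image_of_injOn]
    exact hφ.mono (by exact_mod_cast hsub)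
  rw [hcard]
  refine h _ (fun x hx => ?_) k hk hkm
  obtain ⟨y, hy, rfl⟩ := Finset.mem_image.1 hx
  rcases hX y hy with rfl | ⟨i, hi, rfl | rfl⟩
  · simp
  · exact Or.inr ⟨i, hi, Or.inl rfl⟩
  · exact Or.inr ⟨i, hi, Or.inr (map_neg _ _)⟩

/-- Finitely many real numbers lie in the image of an embedding of a lattice. -/
theorem exists_lattice_coordinates {n : ℕ} (A : Fin n → ℝ) :
    ∃ (d : ℕ) (ψ : (Fin d → ℤ) →+ ℝ) (y : Fin n → Fin d → ℤ), Function.Injective ψ ∧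
      ∀ i, ψ (y i) = A i := by
  let S : Submodule ℤ ℝ := Submodule.span ℤ (Set.range A)
  have : Module.Finite ℤ S := Module.Finite.span_of_finite ℤ (Set.finite_range A)
  have : Module.Free ℤ S := inferInstance
  let e : S ≃ₗ[ℤ] (Fin (finrank ℤ S) → ℤ) := (Module.finBasis ℤ S).equivFun
  refine ⟨finrank ℤ S, (S.subtype.comp e.symm.toLinearMap).toAddMonoidHom,
    fun i => e ⟨A i, Submodule.subset_span ⟨i, rfl⟩⟩, ?_, fun i => ?_⟩
  · exact Subtype.val_injective.comp e.symm.injective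
  · simp

theorem sixteen_pow_le_mul_centralBinom_sq (k : ℕ) (hk : 1 ≤ k) :
    16 ^ k ≤ 4 * k * k.centralBinom ^ 2 := by
  induction k, hk using Nat.le_induction with
  | base => simp [Nat.centralBinom]
  | succ k hk ih =>
    have h := Nat.succ_mul_centralBinom_succ k
    have h1 : (k + 1) * (4 * (k + 1) * (k + 1).centralBinom ^ 2) =
        16 * (2 * k + 1) ^ 2 * k.centralBinom ^ 2 := by
      calc _ = 4 * ((k + 1) * (k + 1).centralBinom) ^ 2 := by ring
        _ = _ := by rw [h]; ring
    refine Nat.le_of_mul_le_mul_left ?_ (Nat.succ_pos k)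
    rw [Nat.succ_eq_add_one, h1, pow_succ]
    nlinarith [Nat.zero_le (k.centralBinom ^ 2), Nat.mul_le_mul_left (k + 1) ih]

theorem two_pow_le_sqrt_mul_choose {n : ℕ} (hn : Even n) (h0 : 0 < n) :
    (2 : ℝ) ^ n ≤ 2 * Real.sqrt n * n.choose (n / 2) := by
  obtain ⟨k, rfl⟩ := hn
  have hk : 1 ≤ k := by omega
  have h : (16 : ℝ) ^ k ≤ 4 * k * (k.centralBinom : ℝ) ^ 2 := by
    exact_mod_cast sixteen_pow_le_mul_centralBinom_sq k hk
  have hc : (k + k).choose ((k + k) / 2) = k.centralBinom := by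
    rw [Nat.centralBinom, ← two_mul, Nat.mul_div_cancel_left _ two_pos]
  rw [hc]
  refine le_of_sq_le_sq ?_ (by positivity)
  rw [mul_pow, mul_pow, Real.sq_sqrt (by positivity)]
  calc ((2 : ℝ) ^ (k + k)) ^ 2 = 16 ^ k := by
        rw [← pow_mul, show (k + k) * 2 = 4 * k by ring, pow_mul]; norm_num
    _ ≤ 4 * k * (k.centralBinom : ℝ) ^ 2 := h
    _ ≤ _ := by
        push_cast
        have : (0 : ℝ) ≤ k * (k.centralBinom : ℝ) ^ 2 := by positivity
        nlinarith

theorem succ_mul_card_differences_le {d : ℕ} {ι : Type} (I : Finset ι) (y : ι → Fin d → ℤ) {i₀ : ι}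
    (hi₀ : i₀ ∈ I) (X₀ : Finset (Fin d → ℤ)) (X : Finset (Fin (d + 1) → ℤ))
    (hX₀ : ∀ x ∈ X₀, ∃ i ∈ I, x = y i - y i₀ ∨ x = y i₀ - y i) (h0 : 0 ∈ X)
    (hX : ∀ i ∈ I, Fin.cons 1 (y i) ∈ X ∧ -(Fin.cons 1 (y i) : Fin (d + 1) → ℤ) ∈ X) (k : ℕ) :
    (k + 1) * (k • X₀).card ≤ ((3 * k) • X).card := by
  let e : (Fin d → ℤ) →+ (Fin (d + 1) → ℤ) :=
    { toFun := fun x => Fin.cons 0 x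
      map_zero' := by ext i; refine Fin.cases ?_ (fun j => ?_) i <;> simp
      map_add' := fun a b => by ext i; refine Fin.cases ?_ (fun j => ?_) i <;> simp }
  have he : ∀ x, e x = Fin.cons 0 x := fun x => rfl
  have hdiff : ∀ i j, e (y i - y j) =
      (Fin.cons 1 (y i) : Fin (d + 1) → ℤ) + -(Fin.cons 1 (y j) : Fin (d + 1) → ℤ) := by
    intro i j
    rw [he]
    ext l
    refine Fin.cases ?_ (fun l => ?_) l
    · simp
    · simp [sub_eq_add_neg]
  have h1 : X₀.image e ⊆ 2 • X := by
    intro x hx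
    obtain ⟨w, hw, rfl⟩ := Finset.mem_image.1 hx
    obtain ⟨i, hi, rfl | rfl⟩ := hX₀ w hw
    · rw [hdiff, two_nsmul]
      exact Finset.add_mem_add (hX i hi).1 (hX i₀ hi₀).2
    · rw [hdiff, two_nsmul]
      exact Finset.add_mem_add (hX i₀ hi₀).1 (hX i hi).2
  have h2 : ∀ w ∈ k • X₀, e w ∈ (2 * k) • X := by
    intro w hw
    rw [mul_nsmul]
    refine Finset.nsmul_subset_nsmul_left h1 ?_
    rw [← Finset.image_nsmul]
    exact Finset.mem_image_of_mem _ hw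
  rw [← Finset.card_range (k + 1), ← Finset.card_product]
  refine Finset.card_le_card_of_injOn
    (fun p => p.1 • (Fin.cons 1 (y i₀) : Fin (d + 1) → ℤ) + e p.2) ?_ ?_
  · rintro ⟨j, w⟩ hp
    simp only [Finset.coe_product, Set.mem_prod, Finset.mem_coe, Finset.mem_range] at hp
    have : 3 * k = k + 2 * k := by ring
    rw [Finset.mem_coe, this, add_nsmul]
    exact Finset.add_mem_add (Finset.nsmul_subset_nsmul_right h0 (by omega)
      (Finset.nsmul_mem_nsmul (hX i₀ hi₀).1)) (h2 w hp.2)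
  · rintro ⟨j, w⟩ - ⟨j', w'⟩ - h
    have hj : j = j' := by
      have := congrFun h 0
      simpa [he] using this
    subst hj
    have hw : e w = e w' := add_left_cancel h
    rw [he, he] at hw
    rw [Fin.cons_injective2 hw |>.2]

theorem exists_gap_of_concentration (D : ℕ) : ∃ (E : ℕ) (K : ℝ) (l₀ : ℕ), 0 < K ∧
    ∀ (n : ℕ) (A : Fin n → ℝ) (ρ a : ℝ), 0 < ρ →
      ρ * 2 ^ n ≤ ({s : Finset (Fin n) | s.card = n / 2 ∧ ∑ i ∈ s, A i = a}.ncard : ℝ) →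
      ∀ n' : ℕ, 0 < n' → n' < n → ∃ m : ℕ, 1 ≤ m ∧ ρ * Real.exp (m / 8) ≤ 20 ∧
        ∀ l : ℕ, l₀ ≤ l → 1 ≤ l → 18 * l ^ 2 * m ≤ n' → 80 ≤ ρ * (l : ℝ) ^ D →
          ∃ (r : ℕ) (P : GAPData ℝ r), r ≤ E ∧ P.IsProper ∧
            n - n' ≤ {i : Fin n | A i ∈ P.toSet}.ncard ∧
            (P.toSet.ncard : ℝ) * (l : ℝ) ^ (r + 1) * ρ * Real.exp (m / 8) ≤ 80 * K := by
  classical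
  obtain ⟨E, K, l₀, hK, hgap⟩ := exists_gap_of_polynomial_growth D
  refine ⟨E, K, l₀, hK, fun n A ρ a hρ hcount n' hn' hn'n => ?_⟩
  obtain ⟨d, ψ, y, hψ, hy⟩ := exists_lattice_coordinates A
  set z : Fin n → Fin (d + 1) → ℤ := fun i => Fin.cons 1 (y i) with hz
  set S : Set (Finset (Fin n)) := {s | s.card = n / 2 ∧ ∑ i ∈ s, A i = a} with hS
  have hzsum : ∀ s : Finset (Fin n), ∑ i ∈ s, z i = Fin.cons (s.card : ℤ) (∑ i ∈ s, y i) := by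
    intro s
    ext j
    rw [Finset.sum_apply]
    refine Fin.cases ?_ (fun j => ?_) j
    · simp [hz]
    · simp [hz, Finset.sum_apply]
  obtain ⟨s₀, hs₀⟩ : S.Nonempty := by
    rw [← Set.ncard_pos]
    have : (0 : ℝ) < ρ * 2 ^ n := by positivity
    exact_mod_cast this.trans_le hcount
  have hsub : S ⊆ ((Finset.univ.filter fun s : Finset (Fin n) =>
      ∑ i ∈ s, z i = ∑ i ∈ s₀, z i : Finset _) : Set (Finset (Fin n))) := by
    intro s hs
    simp only [Finset.coe_filter, Finset.mem_univ, true_and, Set.mem_ofPred_eq]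
    rw [hzsum, hzsum, hs.1, hs₀.1]
    congr 1
    apply hψ
    simp only [map_sum, hy]
    rw [hs.2, hs₀.2]
  have hcount' : ρ * 2 ^ n ≤ (Finset.univ.filter fun s : Finset (Fin n) =>
      ∑ i ∈ s, z i = ∑ i ∈ s₀, z i).card := by
    refine hcount.trans (Nat.cast_le.2 ?_)
    rw [← Set.ncard_coe_finset]
    exact Set.ncard_le_ncard hsub
  obtain ⟨m, I, hm, hm', hI, h⟩ := exists_small_sumset_int z _ hρ hcount' hn'
  refine ⟨m, hm, hm', fun l hl₀ hl hlm hD => ?_⟩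
  obtain ⟨i₀, hi₀⟩ : I.Nonempty := by
    rw [← Finset.card_pos]
    omega
  set X : Finset (Fin (d + 1) → ℤ) := insert 0 (I.image z ∪ I.image fun i => -z i) with hX
  set X₀ : Finset (Fin d → ℤ) :=
    (I.image fun i => y i - y i₀) ∪ I.image fun i => y i₀ - y i with hX₀
  have hmemX₀ : ∀ i ∈ I, y i - y i₀ ∈ X₀ := fun i hi =>
    Finset.mem_union_left _ (Finset.mem_image_of_mem _ hi)
  have hX₀0 : 0 ∈ X₀ := by simpa using hmemX₀ i₀ hi₀
  have hX₀neg : -X₀ = X₀ := by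
    ext x
    simp only [hX₀, Finset.mem_neg', Finset.mem_union, Finset.mem_image]
    constructor
    · rintro (⟨i, hi, h⟩ | ⟨i, hi, h⟩)
      · exact Or.inr ⟨i, hi, by rw [← neg_neg x, ← h, neg_sub]⟩
      · exact Or.inl ⟨i, hi, by rw [← neg_neg x, ← h, neg_sub]⟩
    · rintro (⟨i, hi, rfl⟩ | ⟨i, hi, rfl⟩)
      · exact Or.inr ⟨i, hi, by rw [neg_sub]⟩
      · exact Or.inl ⟨i, hi, by rw [neg_sub]⟩
  have hgrow : (l + 1) * (l • X₀).card ≤ ((3 * l) • X).card := by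
    refine succ_mul_card_differences_le I y hi₀ X₀ X (fun x hx => ?_) (by simp [hX])
      (fun i hi => ⟨?_, ?_⟩) l
    · simp only [hX₀, Finset.mem_union, Finset.mem_image] at hx
      rcases hx with ⟨i, hi, rfl⟩ | ⟨i, hi, rfl⟩
      · exact ⟨i, hi, Or.inl rfl⟩
      · exact ⟨i, hi, Or.inr rfl⟩
    · exact Finset.mem_insert_of_mem
        (Finset.mem_union_left _ (Finset.mem_image_of_mem z hi))
    · exact Finset.mem_insert_of_mem
        (Finset.mem_union_right _ (Finset.mem_image_of_mem (fun i => -z i) hi))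
  have hsmall := h X (fun x hx => by
    simp only [hX, Finset.mem_insert, Finset.mem_union, Finset.mem_image] at hx
    rcases hx with rfl | ⟨i, hi, rfl⟩ | ⟨i, hi, rfl⟩
    · exact Or.inl rfl
    · exact Or.inr ⟨i, hi, Or.inl rfl⟩
    · exact Or.inr ⟨i, hi, Or.inr rfl⟩) (3 * l) (by omega)
      (le_of_eq_of_le (by ring) hlm)
  have hl1 : (1 : ℝ) ≤ l := by exact_mod_cast hl
  have hexp : 1 ≤ Real.exp ((m : ℝ) / 8) := Real.one_le_exp (by positivity)
  have hprod : (l : ℝ) * (l • X₀).card * ρ * Real.exp (m / 8) ≤ 80 := by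
    refine le_trans ?_ hsmall
    have : (l : ℝ) * (l • X₀).card ≤ ((3 * l) • X).card := by
      have h2 : l * (l • X₀).card ≤ ((3 * l) • X).card :=
        (Nat.mul_le_mul_right _ (Nat.le_succ l)).trans hgrow
      exact_mod_cast h2
    gcongr
  have hpoly : ((l • X₀).card : ℝ) ≤ (l : ℝ) ^ D := by
    refine le_of_mul_le_mul_left ?_ hρ
    refine le_trans ?_ hD
    refine le_trans ?_ hprod
    have h3 : (0 : ℝ) ≤ ρ * (l • X₀).card := by positivity
    have h4 : 1 ≤ (l : ℝ) * Real.exp (m / 8) := one_le_mul_of_one_le_of_one_le hl1 hexp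
    nlinarith
  obtain ⟨r, g, M, hr, hmem, hproper, hsize⟩ := hgap d X₀ l hX₀0 hX₀neg hl₀ hpoly
  let P : GAPData ℝ r :=
    { g₀ := A i₀, g := fun i => ψ (g i), N := fun i => -(M i : ℤ), N' := fun i => M i,
      hle := fun i => by simp }
  have hsum : ∀ c : Fin r → ℤ, ∑ i, c i • ψ (g i) = ψ (∑ i, c i • g i) := by
    intro c
    rw [map_sum]
    exact Finset.sum_congr rfl fun i _ => (map_zsmul ψ _ _).symm
  refine ⟨r, P, hr, ?_, ?_, ?_⟩
  · intro c c' hc hc' hcc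
    refine hproper c c' (fun i => abs_le.2 (hc i)) (fun i => abs_le.2 (hc' i)) (hψ ?_)
    rw [← hsum, ← hsum]
    exact add_left_cancel hcc
  · have hIP : (I : Set (Fin n)) ⊆ {i | A i ∈ P.toSet} := by
      intro i hi
      obtain ⟨c, hc, hcx⟩ := hmem _ (hmemX₀ i hi)
      refine ⟨c, fun j => abs_le.1 (hc j), ?_⟩
      change A i = A i₀ + ∑ j, c j • ψ (g j)
      rw [hsum, ← hcx, map_sub, hy, hy]
      ring
    have := Set.ncard_le_ncard hIP
    rw [Set.ncard_coe_finset] at this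
    omega
  · have hP : (P.toSet.ncard : ℝ) ≤ ∏ i, (2 * (M i : ℝ) + 1) := by
      have hsub : P.toSet ⊆ (((Fintype.piFinset fun i => Finset.Icc (-(M i : ℤ)) (M i)).image
          fun c => A i₀ + ∑ i, c i • ψ (g i) : Finset ℝ) : Set ℝ) := by
        rintro x ⟨c, hc, rfl⟩
        simp only [Finset.coe_image, Set.mem_image, Finset.mem_coe, Fintype.mem_piFinset,
          Finset.mem_Icc]
        exact ⟨c, hc, rfl⟩
      have h5 := Set.ncard_le_ncard hsub
      rw [Set.ncard_coe_finset] at h5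
      have h6 := h5.trans Finset.card_image_le
      rw [Fintype.card_piFinset] at h6
      have h7 : ∀ i, (Finset.Icc (-(M i : ℤ)) (M i)).card = 2 * M i + 1 := by
        intro i
        rw [Int.card_Icc]
        omega
      simp only [h7] at h6
      exact_mod_cast h6
    calc (P.toSet.ncard : ℝ) * (l : ℝ) ^ (r + 1) * ρ * Real.exp (m / 8)
        ≤ (∏ i, (2 * (M i : ℝ) + 1)) * (l : ℝ) ^ (r + 1) * ρ * Real.exp (m / 8) := by gcongr
      _ = ((∏ i, (2 * (M i : ℝ) + 1)) * (l : ℝ) ^ r) * (l * ρ * Real.exp (m / 8)) := by ring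
      _ ≤ (K * (l • X₀).card) * (l * ρ * Real.exp (m / 8)) := by gcongr
      _ = K * ((l : ℝ) * (l • X₀).card * ρ * Real.exp (m / 8)) := by ring
      _ ≤ K * 80 := by gcongr
      _ = 80 * K := mul_comm _ _

/-- Near-extremal value of the concentration function. -/
theorem exists_concentration {n : ℕ} (hn : Even n) (h0 : 0 < n) (A : Fin n → ℝ)
    (hρ : 0 < rhoStar n A) : ∃ a : ℝ, rhoStar n A / (4 * Real.sqrt n) * 2 ^ n ≤
      ({s : Finset (Fin n) | s.card = n / 2 ∧ ∑ i ∈ s, A i = a}.ncard : ℝ) := by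
  obtain ⟨a, ha⟩ := exists_lt_of_lt_ciSup (show rhoStar n A / 2 < rhoStar n A by linarith)
  refine ⟨a, ?_⟩
  have hc : (0 : ℝ) < n.choose (n / 2) := by
    exact_mod_cast Nat.choose_pos (Nat.div_le_self n 2)
  rw [lt_div_iff₀ hc] at ha
  refine le_trans ?_ ha.le
  have hs : 0 < Real.sqrt n := Real.sqrt_pos.2 (by exact_mod_cast h0)
  calc rhoStar n A / (4 * Real.sqrt n) * 2 ^ n
      ≤ rhoStar n A / (4 * Real.sqrt n) * (2 * Real.sqrt n * n.choose (n / 2)) := by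
        gcongr
        exact two_pow_le_sqrt_mul_choose hn h0
    _ = _ := by
        field_simp
        ring

/-- Conditions on `n` guaranteeing that logarithmic quantities are dominated by small powers. -/
theorem eventually_scale_conditions {ε C : ℝ} (hε : 0 < ε) (l₀ : ℕ) :
    ∃ n₀ : ℕ, 320 ≤ n₀ ∧ ∀ n : ℕ, n₀ ≤ n → (l₀ : ℝ) ≤ (n : ℝ) ^ (ε / 4) ∧
      576 * (Real.log 80 + (C + 1 / 2) * Real.log n) ≤ (n : ℝ) ^ (ε / 2) := by
  have h1 : ∀ᶠ n : ℕ in Filter.atTop, (l₀ : ℝ) ≤ (n : ℝ) ^ (ε / 4) :=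
    ((tendsto_rpow_atTop (by positivity : 0 < ε / 4)).comp
      tendsto_natCast_atTop_atTop).eventually_ge_atTop _
  have h2 : ∀ᶠ n : ℕ in Filter.atTop,
      576 * (Real.log 80 + (C + 1 / 2) * Real.log n) ≤ (n : ℝ) ^ (ε / 2) := by
    have ho : (fun x : ℝ => 576 * (Real.log 80 + (C + 1 / 2) * Real.log x)) =o[Filter.atTop]
        fun x => x ^ (ε / 2) := by
      refine Asymptotics.IsLittleO.const_mul_left (Asymptotics.IsLittleO.add ?_ ?_) _
      · exact Asymptotics.isLittleO_const_left.2 (Or.inr (Filter.tendsto_abs_atTop_atTop.comp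
          (tendsto_rpow_atTop (by positivity : 0 < ε / 2))))
      · exact (isLittleO_log_rpow_atTop (by positivity)).const_mul_left _
    have := (ho.comp_tendsto (tendsto_natCast_atTop_atTop (R := ℝ))).bound one_pos
    filter_upwards [this] with n hn
    have h3 : (0 : ℝ) ≤ (n : ℝ) ^ (ε / 2) := by positivity
    simp only [Function.comp_apply, one_mul, Real.norm_eq_abs, abs_of_nonneg h3] at hn
    exact (le_abs_self _).trans hn
  obtain ⟨N, hN⟩ := Filter.eventually_atTop.1 (h1.and h2)
  exact ⟨max N 320, le_max_right _ _, fun n hn => hN n ((le_max_left _ _).trans hn)⟩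

theorem pow_mul_le_factorial_mul_exp {m : ℕ} (hm : 1 ≤ m) {s t : ℕ} (hst : s ≤ t) :
    (72 * (m : ℝ)) ^ s ≤ 576 ^ t * t.factorial * Real.exp (m / 8) := by
  have hm' : (1 : ℝ) ≤ m := by exact_mod_cast hm
  have h := Real.pow_div_factorial_le_exp (m / 8 : ℝ) (by positivity) t
  rw [div_le_iff₀ (by positivity)] at h
  calc (72 * (m : ℝ)) ^ s ≤ (72 * (m : ℝ)) ^ t := pow_le_pow_right₀ (by linarith) hst
    _ = 576 ^ t * (m / 8 : ℝ) ^ t := by rw [← mul_pow]; congr 1; ring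
    _ ≤ 576 ^ t * (Real.exp (m / 8) * t.factorial) := by gcongr
    _ = _ := by ring

/-- The scale `l ≈ √(n' / m)` at which the growth of sumsets is examined. -/
theorem exists_scale {n n' m : ℕ} {ε B : ℝ} (hn : 1 ≤ n) (hε : 0 < ε) (hm : 1 ≤ m)
    (hmB : 72 * (m : ℝ) ≤ B) (hB : B ≤ (n : ℝ) ^ (ε / 2)) (hn' : (n : ℝ) ^ ε ≤ n') :
    ∃ l : ℕ, 1 ≤ l ∧ (n : ℝ) ^ (ε / 4) ≤ l ∧ 18 * l ^ 2 * m ≤ n' ∧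
      Real.sqrt n' ≤ l * (72 * m) := by
  have hn1 : (1 : ℝ) ≤ n := by exact_mod_cast hn
  have hm1 : (1 : ℝ) ≤ m := by exact_mod_cast hm
  have hpow : (n : ℝ) ^ (ε / 4) * (n : ℝ) ^ (ε / 4) = (n : ℝ) ^ (ε / 2) := by
    rw [← Real.rpow_add (by linarith)]
    congr 1
    ring
  have hpow' : (n : ℝ) ^ (ε / 2) * (n : ℝ) ^ (ε / 2) = (n : ℝ) ^ ε := by
    rw [← Real.rpow_add (by linarith)]
    congr 1
    ring
  have hone : 1 ≤ (n : ℝ) ^ (ε / 4) := Real.one_le_rpow hn1 (by positivity)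
  set w := (n : ℝ) ^ (ε / 4)
  set x := Real.sqrt (n' / (18 * m)) with hx
  have hx2 : x ^ 2 * (18 * m) = n' := by
    rw [hx, Real.sq_sqrt (by positivity)]
    field_simp
  have hxw : 2 * w ≤ x := by
    refine Real.le_sqrt_of_sq_le ?_
    rw [le_div_iff₀ (by positivity)]
    have h72 : 72 * (m : ℝ) ≤ w * w := by rw [hpow]; exact hmB.trans hB
    calc (2 * w) ^ 2 * (18 * m) = (w * w) * (72 * m) := by ring
      _ ≤ (w * w) * (w * w) := by gcongr
      _ = (n : ℝ) ^ ε := by rw [hpow, hpow']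
      _ ≤ n' := hn'
  have hx0 : 0 ≤ x := Real.sqrt_nonneg _
  have hfl := Nat.floor_le hx0
  have hlt := Nat.lt_floor_add_one x
  refine ⟨⌊x⌋₊, Nat.le_floor (by push_cast; linarith), by linarith, ?_, ?_⟩
  · have : (18 * (⌊x⌋₊ : ℝ) ^ 2 * m) ≤ n' := by
      rw [← hx2]
      calc 18 * (⌊x⌋₊ : ℝ) ^ 2 * m ≤ 18 * x ^ 2 * m := by gcongr
        _ = _ := by ring
    exact_mod_cast this
  · refine Real.sqrt_le_iff.2 ⟨by positivity, ?_⟩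
    have hfx : x ≤ 2 * ⌊x⌋₊ := by linarith
    rw [← hx2]
    calc x ^ 2 * (18 * m) ≤ (2 * ⌊x⌋₊) ^ 2 * (18 * m) := by gcongr
      _ = (⌊x⌋₊ : ℝ) ^ 2 * (72 * m * 1) := by ring
      _ ≤ (⌊x⌋₊ : ℝ) ^ 2 * (72 * m * (72 * m)) := by gcongr; linarith
      _ = _ := by ring

end

theorem stmt4 (ε C : ℝ) (hε0 : 0 < ε) (hε1 : ε < 1) (hC : 0 < C) :
    ∃ (r₀ : ℕ) (K : ℝ) (n₀ : ℕ), ∀ n : ℕ, n₀ ≤ n → Even n →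
      ∀ A : Fin n → ℝ, (n : ℝ) ^ (-C) ≤ rhoStar n A →
        ∀ n' : ℕ, (n : ℝ) ^ ε ≤ (n' : ℝ) → n' < n →
          ∃ (r' : ℕ) (P : GAPData ℝ r'),
            r' ≤ r₀ ∧ P.IsProper ∧
            n - n' ≤ {i : Fin n | A i ∈ P.toSet}.ncard ∧
            (P.toSet.ncard : ℝ) ≤
              K * Real.sqrt ((n : ℝ) / (n' : ℝ)) * (rhoStar n A)⁻¹ / (n' : ℝ) ^ ((r' : ℝ) / 2) := by
  set D := ⌈4 * (C + 2) / ε⌉₊ with hD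
  obtain ⟨E, K, l₀, hK, hmain⟩ := exists_gap_of_concentration D
  obtain ⟨n₀, hn₀, hscale⟩ := eventually_scale_conditions (C := C) hε0 l₀
  refine ⟨E, 320 * K * (576 ^ (E + 1) * (E + 1).factorial), n₀,
    fun n hn heven A hA n' hn' hn'n => ?_⟩
  obtain ⟨hl₀, hlog⟩ := hscale n hn
  have hn0 : 0 < n := by omega
  have hnR : (320 : ℝ) ≤ n := by exact_mod_cast hn₀.trans hn
  have hnpos : (0 : ℝ) < n := by linarith
  have hR : 0 < rhoStar n A := (Real.rpow_pos_of_pos hnpos _).trans_le hA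
  set R := rhoStar n A with hRdef
  have hsn : 0 < Real.sqrt n := Real.sqrt_pos.2 hnpos
  have hn'R : (0 : ℝ) < n' := (Real.rpow_pos_of_pos hnpos _).trans_le hn'
  have hn'0 : 0 < n' := by exact_mod_cast hn'R
  obtain ⟨a, ha⟩ := exists_concentration heven hn0 A hR
  have hρ : 0 < R / (4 * Real.sqrt n) := by positivity
  obtain ⟨m, hm, hexp, hgap⟩ := hmain n A _ a hρ ha n' hn'0 hn'n
  have hRn : 1 ≤ R * (n : ℝ) ^ C := by
    calc (1 : ℝ) = (n : ℝ) ^ (-C) * (n : ℝ) ^ C := by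
          rw [← Real.rpow_add hnpos, neg_add_cancel, Real.rpow_zero]
      _ ≤ R * (n : ℝ) ^ C := by gcongr
  have hsplit : (n : ℝ) ^ (C + 1 / 2) = (n : ℝ) ^ C * Real.sqrt n := by
    rw [Real.rpow_add hnpos, Real.sqrt_eq_rpow]
  have hρn : 1 ≤ R / (4 * Real.sqrt n) * (4 * (n : ℝ) ^ (C + 1 / 2)) := by
    refine hRn.trans_eq ?_
    rw [hsplit]
    field_simp
  have hmlog : 72 * (m : ℝ) ≤ 576 * (Real.log 80 + (C + 1 / 2) * Real.log n) := by
    have h1 : Real.exp ((m : ℝ) / 8) ≤ 80 * (n : ℝ) ^ (C + 1 / 2) := by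
      calc Real.exp ((m : ℝ) / 8)
          ≤ R / (4 * Real.sqrt n) * (4 * (n : ℝ) ^ (C + 1 / 2)) * Real.exp (m / 8) :=
            le_mul_of_one_le_left (Real.exp_pos _).le hρn
        _ = R / (4 * Real.sqrt n) * Real.exp (m / 8) * (4 * (n : ℝ) ^ (C + 1 / 2)) := by ring
        _ ≤ 20 * (4 * (n : ℝ) ^ (C + 1 / 2)) := by gcongr
        _ = _ := by ring
    have h2 := (Real.le_log_iff_exp_le (by positivity)).2 h1
    rw [Real.log_mul (by norm_num) (by positivity), Real.log_rpow hnpos] at h2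
    linarith
  obtain ⟨l, hl1, hnl, hlm, hln'⟩ := exists_scale hn0 hε0 hm hmlog hlog hn'
  have hpow : 80 ≤ R / (4 * Real.sqrt n) * (l : ℝ) ^ D := by
    have h1 : (n : ℝ) ^ (C + 2) ≤ (l : ℝ) ^ D := by
      calc (n : ℝ) ^ (C + 2) ≤ (n : ℝ) ^ (ε / 4 * D) := by
            refine Real.rpow_le_rpow_of_exponent_le (by linarith) ?_
            have := Nat.le_ceil (4 * (C + 2) / ε)
            rw [div_le_iff₀ hε0] at this
            rw [hD]
            linarith
        _ = ((n : ℝ) ^ (ε / 4)) ^ D := by rw [Real.rpow_mul hnpos.le, Real.rpow_natCast]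
        _ ≤ (l : ℝ) ^ D := by gcongr
    have h2 : 80 * (4 * (n : ℝ) ^ (C + 1 / 2)) ≤ (n : ℝ) ^ (C + 2) := by
      calc 80 * (4 * (n : ℝ) ^ (C + 1 / 2)) = 320 * (n : ℝ) ^ (C + 1 / 2) := by ring
        _ ≤ n * (n : ℝ) ^ (C + 1 / 2) := by gcongr
        _ = (n : ℝ) ^ (1 + (C + 1 / 2)) := by rw [Real.rpow_add hnpos 1, Real.rpow_one]
        _ ≤ (n : ℝ) ^ (C + 2) :=
          Real.rpow_le_rpow_of_exponent_le (by linarith) (by linarith)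
    calc (80 : ℝ) ≤ 80 * (R / (4 * Real.sqrt n) * (4 * (n : ℝ) ^ (C + 1 / 2))) := by linarith
      _ = R / (4 * Real.sqrt n) * (80 * (4 * (n : ℝ) ^ (C + 1 / 2))) := by ring
      _ ≤ _ := by gcongr; exact h2.trans h1
  obtain ⟨r, P, hr, hP, hcount, hsize⟩ :=
    hgap l (by exact_mod_cast hl₀.trans hnl) hl1 hlm hpow
  refine ⟨r, P, hr, hP, hcount, ?_⟩
  have hn'pow : (n' : ℝ) ^ ((r : ℝ) / 2) = Real.sqrt n' ^ r := by
    rw [Real.sqrt_eq_rpow, ← Real.rpow_natCast, ← Real.rpow_mul hn'R.le]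
    congr 1
    ring
  have hsn' : 0 < Real.sqrt n' := Real.sqrt_pos.2 hn'R
  rw [hn'pow, Real.sqrt_div' _ hn'R.le, le_div_iff₀ (by positivity)]
  set F : ℝ := 576 ^ (E + 1) * (E + 1).factorial with hF
  have hF0 : 0 < F := by positivity
  have hscaled : Real.sqrt n' ^ (r + 1) ≤ (l : ℝ) ^ (r + 1) * (F * Real.exp (m / 8)) := by
    calc Real.sqrt n' ^ (r + 1) ≤ (l * (72 * m) : ℝ) ^ (r + 1) := by gcongr
      _ = (l : ℝ) ^ (r + 1) * (72 * m : ℝ) ^ (r + 1) := mul_pow _ _ _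
      _ ≤ _ := by
        gcongr
        exact pow_mul_le_factorial_mul_exp hm (Nat.succ_le_succ hr)
  have hfinal : (P.toSet.ncard : ℝ) * Real.sqrt n' ^ (r + 1) * R ≤
      320 * K * F * Real.sqrt n := by
    calc (P.toSet.ncard : ℝ) * Real.sqrt n' ^ (r + 1) * R
        ≤ P.toSet.ncard * ((l : ℝ) ^ (r + 1) * (F * Real.exp (m / 8))) * R := by gcongr
      _ = (P.toSet.ncard * (l : ℝ) ^ (r + 1) * (R / (4 * Real.sqrt n)) * Real.exp (m / 8)) *
          (F * (4 * Real.sqrt n)) := by field_simp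
      _ ≤ (80 * K) * (F * (4 * Real.sqrt n)) := by gcongr
      _ = _ := by ring
  have heq : 320 * K * F * (Real.sqrt n / Real.sqrt n') * R⁻¹ =
      (320 * K * F * Real.sqrt n) / (Real.sqrt n' * R) := by
    field_simp
  rw [heq, le_div_iff₀ (by positivity)]
  refine le_trans (le_of_eq ?_) hfinal
  ring
end

section
/- For every ε ∈ (0,1) there exist constants K_ε and n₀ such that the following holds for all even n ≥ n₀. Let n' satisfy n^{1/2+ε} ≤ n' ≤ n and let A = {a₁, …, a_n} be a multiset of real numbers in which no value occurs more than n − n' − 1 times. Then ρ*(A) ≤ K_ε · √n / n'. -/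
open Finset

/-- The pairs `{i p, j p}` of which `s` contains exactly one element. -/
def splitPairs {ι κ : Type*} [DecidableEq ι] [Fintype κ] (i j : κ → ι) (s : Finset ι) :
    Finset κ :=
  univ.filter fun p => ¬(i p ∈ s ↔ j p ∈ s)

theorem centralBinom_sq_mul_le (l : ℕ) : l.centralBinom ^ 2 * (3 * l + 1) ≤ 16 ^ l := by
  induction l with
  | zero => simp
  | succ l ih =>
    have h := Nat.succ_mul_centralBinom_succ l
    have h2 : (l + 1) ^ 2 * ((l + 1).centralBinom ^ 2 * (3 * (l + 1) + 1))
        ≤ (l + 1) ^ 2 * 16 ^ (l + 1) := by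
      calc (l + 1) ^ 2 * ((l + 1).centralBinom ^ 2 * (3 * (l + 1) + 1))
          = ((l + 1) * (l + 1).centralBinom) ^ 2 * (3 * l + 4) := by ring
        _ = l.centralBinom ^ 2 * (4 * (2 * l + 1) ^ 2 * (3 * l + 4)) := by rw [h]; ring
        _ ≤ l.centralBinom ^ 2 * ((3 * l + 1) * (16 * (l + 1) ^ 2)) := by
            refine Nat.mul_le_mul_left _ ?_
            nlinarith
        _ = (l.centralBinom ^ 2 * (3 * l + 1)) * (16 * (l + 1) ^ 2) := by ring
        _ ≤ 16 ^ l * (16 * (l + 1) ^ 2) := by gcongr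
        _ = (l + 1) ^ 2 * 16 ^ (l + 1) := by ring
    exact Nat.le_of_mul_le_mul_left h2 (by positivity)

theorem choose_half_sq_mul_le (k : ℕ) : k.choose (k / 2) ^ 2 * (k + 1) ≤ 4 ^ k := by
  obtain ⟨l, rfl | rfl⟩ := Nat.even_or_odd' k
  · have h := centralBinom_sq_mul_le l
    rw [Nat.centralBinom] at h
    rw [Nat.mul_div_cancel_left _ (by norm_num), pow_mul]
    calc _ ≤ (2 * l).choose l ^ 2 * (3 * l + 1) := by gcongr; omega
      _ ≤ _ := h
  · have h := centralBinom_sq_mul_le (l + 1)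
    have hc : (l + 1).centralBinom = 2 * (2 * l + 1).choose l := by
      rw [Nat.centralBinom, show 2 * (l + 1) = (2 * l + 1) + 1 by ring, Nat.choose_succ_succ,
        Nat.choose_symm_half]
      ring
    rw [hc] at h
    rw [show (2 * l + 1) / 2 = l by omega]
    have h4 : (4 : ℕ) ^ (2 * l + 1) * 4 = 16 ^ (l + 1) := by
      rw [← pow_succ, show 2 * l + 1 + 1 = 2 * (l + 1) by ring, pow_mul]
      norm_num
    nlinarith [Nat.zero_le ((2 * l + 1).choose l ^ 2 * l)]

theorem choose_half_div_two_pow_le (k : ℕ) :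
    (k.choose (k / 2) : ℝ) / 2 ^ k ≤ 1 / √(k + 1) := by
  have hk : (0 : ℝ) < k + 1 := by positivity
  rw [div_le_div_iff₀ (by positivity) (Real.sqrt_pos.2 hk), one_mul]
  refine (pow_le_pow_iff_left₀ (by positivity) (by positivity) two_ne_zero).1 ?_
  rw [mul_pow, Real.sq_sqrt hk.le, ← pow_mul, mul_comm k 2, pow_mul]
  norm_num
  exact_mod_cast choose_half_sq_mul_le k

/-- The Littlewood–Offord bound for positive weights. -/
theorem card_subset_sum_eq_le_of_pos {κ : Type*} [Fintype κ] [DecidableEq κ] (d : κ → ℝ)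
    (hd : ∀ p, 0 < d p) (b : ℝ) :
    #{g : Finset κ | ∑ p ∈ g, d p = b} ≤
      (Fintype.card κ).choose (Fintype.card κ / 2) := by
  apply IsAntichain.sperner
  intro g hg g' hg' hne hle
  simp only [coe_filter, mem_univ, true_and, Set.mem_ofPred_eq] at hg hg'
  have hlt : ∑ p ∈ g, d p < ∑ p ∈ g', d p := by
    obtain ⟨p, hp, hpg⟩ := Finset.exists_of_ssubset (lt_of_le_of_ne hle hne)
    exact sum_lt_sum_of_subset hle hp hpg (hd p) fun q _ _ => (hd q).le
  linarith

/-- The Littlewood–Offord bound for nonzero weights. -/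
theorem card_subset_sum_eq_le_of_ne_zero {κ : Type*} [Fintype κ] [DecidableEq κ] (d : κ → ℝ)
    (hd : ∀ p, d p ≠ 0) (b : ℝ) :
    #{g : Finset κ | ∑ p ∈ g, d p = b} ≤
      (Fintype.card κ).choose (Fintype.card κ / 2) := by
  let neg : Finset κ := univ.filter fun p => d p < 0
  refine le_trans ?_ (card_subset_sum_eq_le_of_pos (fun p => |d p|) (fun p => abs_pos.2 (hd p))
    (b - ∑ p ∈ neg, d p))
  apply card_le_card_of_injOn (fun g => symmDiff g neg)
  · intro g hg
    simp only [coe_filter, mem_univ, true_and, Set.mem_ofPred_eq] at hg ⊢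
    have hind : ∀ (t : Finset κ) (f : κ → ℝ), ∑ p ∈ t, f p = ∑ p, if p ∈ t then f p else 0 :=
      fun t f => by simp
    rw [← hg, hind, hind g, hind neg, ← sum_sub_distrib]
    refine sum_congr rfl fun p _ => ?_
    by_cases h1 : p ∈ g <;> by_cases h2 : d p < 0 <;>
      simp [mem_symmDiff, neg, h1, h2, abs_of_neg, abs_of_nonneg, not_lt.1]
  · intro g _ g' _ h
    exact symmDiff_left_injective neg h

/-- The Littlewood–Offord bound when some of the weights vanish. -/
theorem card_subset_sum_eq_le {κ : Type*} [Fintype κ] [DecidableEq κ] (d : κ → ℝ) (b : ℝ) :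
    (#{g : Finset κ | ∑ p ∈ g, d p = b} : ℝ) ≤
      2 ^ Fintype.card κ * (1 / √(#{p | d p ≠ 0} + 1)) := by
  let k := Fintype.card {p // d p ≠ 0}
  have hk : #{p | d p ≠ 0} = k := (Fintype.card_subtype _).symm
  have hnat : #{g : Finset κ | ∑ p ∈ g, d p = b} ≤
      k.choose (k / 2) * 2 ^ Fintype.card {p // ¬ d p ≠ 0} := by
    refine le_trans ?_ (Nat.mul_le_mul_right _
      (card_subset_sum_eq_le_of_ne_zero (fun p : {p // d p ≠ 0} => d p) (fun p => p.2) b))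
    rw [← Fintype.card_finset, ← card_univ (α := Finset {p // ¬ d p ≠ 0}), ← card_product]
    apply card_le_card_of_injOn
      fun g => (g.subtype fun p => d p ≠ 0, g.subtype fun p => ¬ d p ≠ 0)
    · intro g hg
      simp only [coe_filter, mem_univ, true_and, Set.mem_ofPred_eq] at hg
      simp only [mem_coe, mem_product, mem_filter, mem_univ, true_and, and_true]
      rw [sum_subtype_eq_sum_filter, sum_filter_ne_zero, hg]
    · intro g _ g' _ h
      rw [Prod.mk.injEq] at h
      ext p
      by_cases hp : d p ≠ 0
      · simpa using Finset.ext_iff.1 h.1 ⟨p, hp⟩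
      · simpa using Finset.ext_iff.1 h.2 ⟨p, hp⟩
  have hcard : Fintype.card κ = k + Fintype.card {p // ¬ d p ≠ 0} := by
    rw [← Fintype.card_sum]
    exact Fintype.card_congr (Equiv.sumCompl _).symm
  have hchoose := choose_half_div_two_pow_le k
  rw [div_le_iff₀ (by positivity)] at hchoose
  rw [hk, hcard, pow_add]
  calc (#{g : Finset κ | ∑ p ∈ g, d p = b} : ℝ)
      ≤ k.choose (k / 2) * 2 ^ Fintype.card {p // ¬ d p ≠ 0} := by exact_mod_cast hnat
    _ ≤ 1 / √(k + 1) * 2 ^ k * 2 ^ Fintype.card {p // ¬ d p ≠ 0} := by gcongr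
    _ = _ := by ring

/-- Swapping the two elements of the pairs indexed by `g`. -/
theorem exists_perm_swapping_pairs {ι κ : Type*} [DecidableEq ι] [DecidableEq κ]
    (i j : κ → ι) (hi : i.Injective) (hj : j.Injective) (hij : ∀ p q, i p ≠ j q)
    (A : ι → ℝ) (g : Finset κ) :
    ∃ σ : Equiv.Perm ι, ∀ x, A (σ x) = A x +
      ∑ p ∈ g, (A (j p) - A (i p)) * ((if i p = x then 1 else 0) - if j p = x then 1 else 0) := by
  induction g using Finset.induction_on with
  | empty => exact ⟨1, by simp⟩
  | insert q g hq ih =>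
    obtain ⟨σ, hσ⟩ := ih
    refine ⟨(Equiv.swap (i q) (j q)).trans σ, fun x => ?_⟩
    have hz : ∀ x, x = i q ∨ x = j q → ∑ p ∈ g, (A (j p) - A (i p)) *
        ((if i p = x then (1 : ℝ) else 0) - if j p = x then 1 else 0) = 0 := by
      intro x hx
      refine sum_eq_zero fun p hp => ?_
      have hpq : p ≠ q := fun h => hq (h ▸ hp)
      rcases hx with rfl | rfl
      · simp [hi.ne hpq, (hij q p).symm]
      · simp [hj.ne hpq, hij p q]
    rw [sum_insert hq, Equiv.trans_apply]
    by_cases h1 : x = i q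
    · subst h1
      rw [Equiv.swap_apply_left, hσ, hz _ (Or.inr rfl), hz _ (Or.inl rfl)]
      simp [(hij q q).symm]
    by_cases h2 : x = j q
    · subst h2
      rw [Equiv.swap_apply_right, hσ, hz _ (Or.inl rfl), hz _ (Or.inr rfl)]
      simp [hij q q]
    · rw [Equiv.swap_apply_of_ne_of_ne h1 h2, hσ]
      simp [Ne.symm h1, Ne.symm h2]

theorem card_slice_sum_eq_le {ι κ : Type*} [Fintype ι] [DecidableEq ι] [Fintype κ]
    [DecidableEq κ] (i j : κ → ι) (hi : i.Injective) (hj : j.Injective)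
    (hij : ∀ p q, i p ≠ j q) (A : ι → ℝ) (hA : ∀ p, A (i p) ≠ A (j p)) (h : ℕ) (a : ℝ) :
    (#{s ∈ powersetCard h (univ : Finset ι) | ∑ x ∈ s, A x = a} : ℝ) ≤
      ∑ s ∈ powersetCard h (univ : Finset ι), 1 / √(#(splitPairs i j s) + 1) := by
  choose σ hσ using exists_perm_swapping_pairs i j hi hj hij A
  let w : Finset ι → κ → ℝ := fun s p =>
    (A (j p) - A (i p)) * ((if i p ∈ s then 1 else 0) - if j p ∈ s then 1 else 0)
  have hsum : ∀ g (s : Finset ι), ∑ x ∈ s.map (σ g).toEmbedding, A x =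
      ∑ x ∈ s, A x + ∑ p ∈ g, w s p := by
    intro g s
    simp only [sum_map, Equiv.coe_toEmbedding, hσ, sum_add_distrib]
    rw [sum_comm]
    simp only [w, ← mul_sum, sum_sub_distrib, sum_ite_eq]
  have hw : ∀ s, univ.filter (fun p => w s p ≠ 0) = splitPairs i j s := by
    intro s
    ext p
    have : A (j p) - A (i p) ≠ 0 := sub_ne_zero.2 (hA p).symm
    by_cases h1 : i p ∈ s <;> by_cases h2 : j p ∈ s <;> simp [w, splitPairs, h1, h2, this]
  have hinv : ∀ g, (#{s ∈ powersetCard h (univ : Finset ι) | ∑ x ∈ s, A x = a} : ℝ) =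
      ∑ s ∈ powersetCard h (univ : Finset ι),
        if ∑ p ∈ g, w s p = a - ∑ x ∈ s, A x then (1 : ℝ) else 0 := by
    intro g
    rw [card_filter, Nat.cast_sum]
    refine (sum_equiv (Equiv.finsetCongr (σ g)) ?_ ?_).symm
    · intro s; simp [mem_powersetCard]
    · intro s _
      rw [Equiv.finsetCongr_apply, hsum]
      push_cast
      congr 1
      rw [eq_iff_iff]
      constructor <;> intro h <;> linarith
  have hcount : 2 ^ Fintype.card κ *
      (#{s ∈ powersetCard h (univ : Finset ι) | ∑ x ∈ s, A x = a} : ℝ) =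
      ∑ s ∈ powersetCard h (univ : Finset ι),
        (#{g : Finset κ | ∑ p ∈ g, w s p = a - ∑ x ∈ s, A x} : ℝ) := by
    have h1 := sum_congr (rfl : (univ : Finset (Finset κ)) = univ) fun g _ => hinv g
    rw [sum_const, sum_comm, card_univ, Fintype.card_finset, nsmul_eq_mul] at h1
    push_cast at h1
    rw [h1]
    refine sum_congr rfl fun s _ => ?_
    rw [card_filter, Nat.cast_sum]
    simp
  refine le_of_mul_le_mul_left ?_ (by positivity : (0 : ℝ) < 2 ^ Fintype.card κ)
  rw [hcount, mul_sum]
  refine sum_le_sum fun s _ => ?_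
  rw [← hw]
  exact card_subset_sum_eq_le _ _

/-- The generating function of the number of split pairs of a random subset. -/
theorem sum_pow_card_splitPairs {ι κ : Type*} [Fintype ι] [DecidableEq ι] [Fintype κ]
    [DecidableEq κ] (i j : κ → ι) (hi : i.Injective) (hij : ∀ p q, i p ≠ j q) (t : ℝ) :
    ∑ s : Finset ι, t ^ #(splitPairs i j s) =
      2 ^ Fintype.card ι * ((1 + t) / 2) ^ Fintype.card κ := by
  let w : κ → Finset ι → ℝ := fun p s => if (i p ∈ s ↔ j p ∈ s) then 1 else t
  have key : ∀ P : Finset κ, ∑ s : Finset ι, ∏ p ∈ P, w p s =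
      2 ^ Fintype.card ι * ((1 + t) / 2) ^ #P := by
    intro P
    induction P using Finset.induction_on with
    | empty => simp
    | insert q P hq ih =>
      have htog : ∑ s : Finset ι, ∏ p ∈ insert q P, w p s =
          ∑ s : Finset ι, w q (symmDiff s {i q}) * ∏ p ∈ P, w p s := by
        rw [← Equiv.sum_comp (symmDiff_left_involutive ({i q} : Finset ι)).toPerm]
        refine sum_congr rfl fun s _ => ?_
        rw [prod_insert hq]
        congr 1
        refine prod_congr rfl fun p hp => ?_
        have hpq : p ≠ q := fun h => hq (h ▸ hp)
        simp [w, mem_symmDiff, hi.ne hpq, (hij q p).symm]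
      have hadd : ∀ s, w q s + w q (symmDiff s {i q}) = 1 + t := by
        intro s
        by_cases h1 : i q ∈ s <;> by_cases h2 : j q ∈ s <;>
          simp [w, mem_symmDiff, h1, h2, (hij q q).symm, add_comm]
      have hdbl : ∑ s : Finset ι, ∏ p ∈ insert q P, w p s +
          ∑ s : Finset ι, ∏ p ∈ insert q P, w p s = (1 + t) * ∑ s : Finset ι, ∏ p ∈ P, w p s := by
        nth_rewrite 2 [htog]
        rw [← sum_add_distrib, mul_sum]
        refine sum_congr rfl fun s _ => ?_
        rw [prod_insert hq, ← add_mul, hadd]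
      rw [ih] at hdbl
      rw [card_insert_of_notMem hq, pow_succ]
      linarith
  rw [← card_univ (α := κ), ← key univ]
  refine sum_congr rfl fun s _ => ?_
  simp only [w, splitPairs]
  rw [prod_ite]
  simp

/-- Disjoint pairs of indices at which `A` takes different values. -/
theorem exists_disjoint_pairs (n L : ℕ) (hL : n ≤ 2 * L) (A : Fin n → ℝ)
    (hA : ∀ x : ℝ, {i : Fin n | A i = x}.ncard ≤ L) :
    ∃ i j : Fin (n - L) → Fin n, i.Injective ∧ j.Injective ∧ (∀ p q, i p ≠ j q) ∧
      ∀ p, A (i p) ≠ A (j p) := by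
  let σ := Tuple.sort A
  have hσ : Monotone (A ∘ σ) := Tuple.monotone_sort A
  refine ⟨fun p => σ ⟨p, by omega⟩, fun p => σ ⟨p + L, by omega⟩, ?_, ?_, ?_, ?_⟩
  · intro p q hpq
    simpa [Fin.ext_iff] using hpq
  · intro p q hpq
    simpa [Fin.ext_iff] using hpq
  · intro p q hpq
    have := congrArg Fin.val (σ.injective hpq)
    simp only at this
    omega
  · intro p hp
    have hsub : (σ '' (Icc (⟨p, by omega⟩ : Fin n) ⟨p + L, by omega⟩ : Finset (Fin n))) ⊆
        {i : Fin n | A i = A (σ ⟨p, by omega⟩)} := by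
      rintro _ ⟨x, hx, rfl⟩
      rw [mem_coe, mem_Icc] at hx
      exact le_antisymm ((hσ hx.2).trans_eq hp.symm) (hσ hx.1)
    have h1 := Set.ncard_le_ncard hsub (Set.toFinite _)
    rw [Set.ncard_image_of_injective _ σ.injective, Set.ncard_coe_finset, Fin.card_Icc] at h1
    have h2 := hA (A (σ ⟨p, by omega⟩))
    simp only at h1
    omega

theorem one_div_sqrt_le_add (m k : ℕ) (hm : 0 < m) :
    1 / √((k : ℝ) + 1) ≤ 3 / √m + (3 / 2) ^ m * (1 / 16) ^ k := by
  have hm' : (0 : ℝ) < m := by exact_mod_cast hm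
  have hk : (0 : ℝ) < k + 1 := by positivity
  rcases le_or_gt (8 * k) m with h | h
  · have h1 : (1 : ℝ) ≤ (3 / 2) ^ m * (1 / 16) ^ k := by
      calc (1 : ℝ) ≤ ((3 / 2) ^ 8 * (1 / 16)) ^ k := one_le_pow₀ (by norm_num)
        _ = (3 / 2) ^ (8 * k) * (1 / 16) ^ k := by rw [mul_pow, pow_mul]
        _ ≤ _ := by gcongr; norm_num
    have h2 : 1 / √((k : ℝ) + 1) ≤ 1 := by
      rw [div_le_one (Real.sqrt_pos.2 hk)]
      exact Real.one_le_sqrt.2 (by linarith [(Nat.cast_nonneg k : (0 : ℝ) ≤ k)])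
    have : 0 ≤ 3 / √(m : ℝ) := by positivity
    linarith
  · have h1 : 1 / √((k : ℝ) + 1) ≤ 3 / √m := by
      rw [div_le_div_iff₀ (Real.sqrt_pos.2 hk) (Real.sqrt_pos.2 hm'), one_mul]
      refine (pow_le_pow_iff_left₀ (by positivity) (by positivity) two_ne_zero).1 ?_
      rw [mul_pow, Real.sq_sqrt hk.le, Real.sq_sqrt hm'.le]
      have : (m : ℝ) < 8 * k := by exact_mod_cast h
      linarith
    have : (0 : ℝ) ≤ (3 / 2) ^ m * (1 / 16) ^ k := by positivity
    linarith

/-- Concentration on the middle slice, given disjoint pairs on which `A` is not constant. -/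
theorem card_middle_slice_sum_eq_div_le (h m : ℕ) (hh : 0 < h) (hm : 0 < m)
    (i j : Fin m → Fin (2 * h)) (hi : i.Injective) (hj : j.Injective) (hij : ∀ p q, i p ≠ j q)
    (A : Fin (2 * h) → ℝ) (hA : ∀ p, A (i p) ≠ A (j p)) (a : ℝ) :
    (#{s ∈ powersetCard h (univ : Finset (Fin (2 * h))) | ∑ x ∈ s, A x = a} : ℝ) /
      (h.centralBinom : ℝ) ≤ 3 / √m + 2 * h * (51 / 64) ^ m := by
  have hN : (0 : ℝ) < h.centralBinom := by exact_mod_cast Nat.centralBinom_pos h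
  have hN4 : (4 : ℝ) ^ h ≤ 2 * h * h.centralBinom := by
    exact_mod_cast Nat.four_pow_le_two_mul_self_mul_centralBinom h hh
  rw [div_le_iff₀ hN]
  calc _ ≤ ∑ s ∈ powersetCard h (univ : Finset (Fin (2 * h))),
          1 / √((#(splitPairs i j s) : ℝ) + 1) :=
        card_slice_sum_eq_le i j hi hj hij A hA h a
    _ ≤ ∑ s ∈ powersetCard h (univ : Finset (Fin (2 * h))),
          (3 / √m + (3 / 2) ^ m * (1 / 16) ^ #(splitPairs i j s)) :=
        sum_le_sum fun s _ => one_div_sqrt_le_add m _ hm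
    _ = h.centralBinom * (3 / √m) + (3 / 2) ^ m *
          ∑ s ∈ powersetCard h (univ : Finset (Fin (2 * h))),
            (1 / 16 : ℝ) ^ #(splitPairs i j s) := by
        rw [sum_add_distrib, sum_const, card_powersetCard, card_univ, Fintype.card_fin,
          nsmul_eq_mul, mul_sum, Nat.centralBinom]
    _ ≤ h.centralBinom * (3 / √m) + (3 / 2) ^ m *
          ∑ s : Finset (Fin (2 * h)), (1 / 16 : ℝ) ^ #(splitPairs i j s) := by
        gcongr
        exact subset_univ _
    _ = h.centralBinom * (3 / √m) + (51 / 64) ^ m * 4 ^ h := by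
        rw [sum_pow_card_splitPairs i j hi hij, Fintype.card_fin, Fintype.card_fin, pow_mul,
          mul_left_comm, ← mul_pow]
        norm_num
        ring
    _ ≤ h.centralBinom * (3 / √m) + (51 / 64) ^ m * (2 * h * h.centralBinom) := by gcongr
    _ = _ := by ring

theorem exists_forall_pow_mul_geometric_le :
    ∃ B : ℝ, 0 < B ∧ ∀ m : ℕ, (m : ℝ) ^ 3 * (51 / 64) ^ m ≤ B := by
  have h := tendsto_pow_const_mul_const_pow_of_abs_lt_one 3
    (show |(51 / 64 : ℝ)| < 1 by rw [abs_lt]; norm_num)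
  obtain ⟨B, hB⟩ := h.bddAbove_range
  exact ⟨max B 1, by positivity, fun m => (hB ⟨m, rfl⟩).trans (le_max_left _ _)⟩

theorem stmt5 (ε : ℝ) (hε0 : 0 < ε) (hε1 : ε < 1) :
    ∃ (Kε : ℝ) (n₀ : ℕ), 0 < Kε ∧ ∀ n : ℕ, n₀ ≤ n → Even n →
      ∀ n' : ℕ, (n : ℝ) ^ ((1 : ℝ) / 2 + ε) ≤ (n' : ℝ) → n' ≤ n →
        ∀ A : Fin n → ℝ, (∀ x : ℝ, {i : Fin n | A i = x}.ncard ≤ n - n' - 1) →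
          rhoStar n A ≤ Kε * Real.sqrt n / (n' : ℝ) := by
  obtain ⟨B, hB0, hB⟩ := exists_forall_pow_mul_geometric_le
  refine ⟨2 * (3 + 4 * B), 1, by positivity, ?_⟩
  intro n hn hev n' hn'1 hn'2 A hA
  obtain ⟨h, rfl⟩ := hev.two_dvd
  have hh : 0 < h := by omega
  have hn1 : (1 : ℝ) ≤ (2 * h : ℕ) := by exact_mod_cast hn
  have hsq : √((2 * h : ℕ) : ℝ) ≤ n' := by
    rw [Real.sqrt_eq_rpow]
    exact (Real.rpow_le_rpow_of_exponent_le hn1 (by linarith)).trans hn'1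
  have hn'pos : (0 : ℝ) < n' := lt_of_lt_of_le (Real.sqrt_pos.2 (by linarith)) hsq
  have hnsq : ((2 * h : ℕ) : ℝ) ≤ n' ^ 2 := (Real.sqrt_le_left hn'pos.le).1 hsq
  have hn'pos' : 0 < n' := by exact_mod_cast hn'pos
  have hlt : n' + 1 < 2 * h := by
    by_contra hcon
    have h0 := hA (A ⟨0, by omega⟩)
    have h1 : 0 < {i : Fin (2 * h) | A i = A ⟨0, by omega⟩}.ncard :=
      (Set.ncard_pos (Set.toFinite _)).2 ⟨_, rfl⟩
    omega
  obtain ⟨i, j, hi, hj, hij, hne⟩ := exists_disjoint_pairs (2 * h) (max (2 * h - n' - 1) h)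
    (by omega) A fun x => (hA x).trans (le_max_left _ _)
  generalize hm : 2 * h - max (2 * h - n' - 1) h = m at i j hi hj hij hne
  have hmpos : 0 < m := by omega
  have hmn : n' ≤ 2 * m := by omega
  have hm0 : (0 : ℝ) < m := by exact_mod_cast hmpos
  have hm1 : (1 : ℝ) ≤ m := by exact_mod_cast hmpos
  have hmn' : (n' : ℝ) ≤ 2 * m := by exact_mod_cast hmn
  have hsm : 0 < √(m : ℝ) := Real.sqrt_pos.2 hm0
  have hbound : 3 / √(m : ℝ) + 2 * h * (51 / 64) ^ m ≤ (3 + 4 * B) / √m := by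
    rw [add_div]
    gcongr
    rw [le_div_iff₀ hsm]
    have h1 : (2 * h : ℝ) ≤ 4 * m ^ 2 := by
      push_cast at hnsq
      nlinarith
    have h2 : √(m : ℝ) ≤ m := Real.sqrt_le_iff.2 ⟨hm0.le, by nlinarith⟩
    calc 2 * (h : ℝ) * (51 / 64) ^ m * √m ≤ 4 * m ^ 2 * (51 / 64) ^ m * m := by gcongr
      _ = 4 * ((m : ℝ) ^ 3 * (51 / 64) ^ m) := by ring
      _ ≤ 4 * B := by gcongr; exact hB m
  have hfinal : (3 + 4 * B) / √(m : ℝ) ≤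
      2 * (3 + 4 * B) * √((2 * h : ℕ) : ℝ) / n' := by
    rw [div_le_div_iff₀ hsm hn'pos]
    have h1 : √(m : ℝ) ≤ √((2 * h : ℕ) : ℝ) :=
      Real.sqrt_le_sqrt (by exact_mod_cast (by omega : m ≤ 2 * h))
    have h2 : (n' : ℝ) ≤ 2 * √((2 * h : ℕ) : ℝ) * √m := by
      nlinarith [Real.mul_self_sqrt hm0.le]
    calc (3 + 4 * B) * (n' : ℝ) ≤ (3 + 4 * B) * (2 * √((2 * h : ℕ) : ℝ) * √m) := by gcongr
      _ = _ := by ring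
  refine ciSup_le fun a => ?_
  refine le_trans ?_ (hbound.trans hfinal)
  have hcard := card_middle_slice_sum_eq_div_le h m hh hmpos i j hi hj hij A hne a
  rw [Nat.mul_div_cancel_left _ (by norm_num : 0 < 2)]
  refine le_of_eq_of_le ?_ hcard
  rw [← Set.ncard_coe_finset, Nat.centralBinom]
  congr 3
  ext s
  simp [mem_powersetCard]
end
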